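/- arXiv:math/0703569 — 2 statements merged into one kernel-verified Lean document; each statement's English description precedes it below -/
import Mathlib

section
/- Let α, β be real numbers with α ≥ β > -1 and α ≥ -1/2. For each integer k ≥ 0 let P_k be a real polynomial of degree exactly k with P_k(1) > 0 and ∫_{-1}^{1} P_k(t) t^j (1-t)^α (1+t)^β dt = 0 for all 0 ≤ j < k. Let l be a nonnegative integer and let f : [-1,1] → ℝ be continuous, with f(t) ≥ 0 for all t ∈ (-1,1), f not identically zero, and c_k[f] := ∫_{-1}^{1} f(t) P_k(t) (1-t)^α (1+t)^β dt ≤ 0 for all k ≥ l+1. Then the Jacobi–Fourier series Σ_{k=0}^∞ (c_k[f] / ∫_{-1}^{1} P_k(t)² (1-t)^α (1+t)^β dt) · P_k(t) converges absolutely and uniformly on [-1,1], and its sum equals f(t) for every t ∈ [-1,1]. -/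
open MeasureTheory Polynomial

/-- The Jacobi–Fourier coefficient `∫_{-1}^1 f(t) P(t) (1-t)^α (1+t)^β dt`. -/
noncomputable def jacobiCoeff (α β : ℝ) (P : Polynomial ℝ) (f : ℝ → ℝ) : ℝ :=
  ∫ t in (-1:ℝ)..1, f t * P.eval t * (1 - t) ^ α * (1 + t) ^ β

/-- The squared weighted `L²` norm `∫_{-1}^1 P(t)² (1-t)^α (1+t)^β dt`. -/
noncomputable def jacobiNormSq (α β : ℝ) (P : Polynomial ℝ) : ℝ :=
  ∫ t in (-1:ℝ)..1, P.eval t ^ 2 * (1 - t) ^ α * (1 + t) ^ β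

/-- The Jacobi weight `(1-t)^α (1+t)^β`. -/
noncomputable def jacobiWeight (α β t : ℝ) : ℝ := (1 - t) ^ α * (1 + t) ^ β

/-- The integral over `[-1,1]` against the Jacobi weight. -/
noncomputable def jacobiIntegral (α β : ℝ) (g : ℝ → ℝ) : ℝ :=
  ∫ t in (-1:ℝ)..1, g t * jacobiWeight α β t

lemma jacobiWeight_pos (α β : ℝ) {t : ℝ} (ht : t ∈ Set.Ioo (-1:ℝ) 1) :
    0 < jacobiWeight α β t :=
  mul_pos (Real.rpow_pos_of_pos (by linarith [ht.2]) _)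
    (Real.rpow_pos_of_pos (by linarith [ht.1]) _)

lemma jacobiWeight_nonneg (α β : ℝ) {t : ℝ} (ht : t ∈ Set.Icc (-1:ℝ) 1) :
    0 ≤ jacobiWeight α β t :=
  mul_nonneg (Real.rpow_nonneg (by linarith [ht.2]) _) (Real.rpow_nonneg (by linarith [ht.1]) _)

lemma intervalIntegrable_jacobiWeight {α β : ℝ} (hα : -1 < α) (hβ : -1 < β) :
    IntervalIntegrable (jacobiWeight α β) volume (-1) 1 := by
  have hleft : IntervalIntegrable (jacobiWeight α β) volume (-1) 0 := by
    have h : IntervalIntegrable (fun t : ℝ => (1 + t) ^ β) volume (-1) 0 := by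
      simpa using (intervalIntegral.intervalIntegrable_rpow' (a := 0) (b := 1) hβ).comp_add_left 1
    refine h.continuousOn_mul (g := fun t : ℝ => (1 - t) ^ α) ?_
    refine ContinuousOn.rpow_const (by fun_prop) fun t ht => Or.inl ?_
    rw [Set.uIcc_of_le (by norm_num)] at ht
    linarith [ht.2]
  have hright : IntervalIntegrable (jacobiWeight α β) volume 0 1 := by
    have h : IntervalIntegrable (fun t : ℝ => (1 - t) ^ α) volume 0 1 := by
      simpa using
        ((intervalIntegral.intervalIntegrable_rpow' (a := 0) (b := 1) hα).comp_sub_left 1).symm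
    refine h.mul_continuousOn (g := fun t : ℝ => (1 + t) ^ β) ?_
    refine ContinuousOn.rpow_const (by fun_prop) fun t ht => Or.inl ?_
    rw [Set.uIcc_of_le (by norm_num)] at ht
    linarith [ht.1]
  exact hleft.trans hright

lemma intervalIntegrable_mul_jacobiWeight {α β : ℝ} (hα : -1 < α) (hβ : -1 < β) {g : ℝ → ℝ}
    (hg : ContinuousOn g (Set.Icc (-1) 1)) :
    IntervalIntegrable (fun t => g t * jacobiWeight α β t) volume (-1) 1 :=
  (intervalIntegrable_jacobiWeight hα hβ).continuousOn_mul
    (by rwa [Set.uIcc_of_le (by norm_num)])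

lemma jacobiIntegral_add {α β : ℝ} (hα : -1 < α) (hβ : -1 < β) {g h : ℝ → ℝ}
    (hg : ContinuousOn g (Set.Icc (-1) 1)) (hh : ContinuousOn h (Set.Icc (-1) 1)) :
    jacobiIntegral α β (fun t => g t + h t) = jacobiIntegral α β g + jacobiIntegral α β h := by
  simp only [jacobiIntegral, add_mul]
  exact intervalIntegral.integral_add (intervalIntegrable_mul_jacobiWeight hα hβ hg)
    (intervalIntegrable_mul_jacobiWeight hα hβ hh)

lemma jacobiIntegral_const_mul (α β c : ℝ) (g : ℝ → ℝ) :
    jacobiIntegral α β (fun t => c * g t) = c * jacobiIntegral α β g := by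
  simp only [jacobiIntegral, mul_assoc, intervalIntegral.integral_const_mul]

lemma jacobiIntegral_sub {α β : ℝ} (hα : -1 < α) (hβ : -1 < β) {g h : ℝ → ℝ}
    (hg : ContinuousOn g (Set.Icc (-1) 1)) (hh : ContinuousOn h (Set.Icc (-1) 1)) :
    jacobiIntegral α β (fun t => g t - h t) = jacobiIntegral α β g - jacobiIntegral α β h := by
  simp only [jacobiIntegral, sub_mul]
  exact intervalIntegral.integral_sub (intervalIntegrable_mul_jacobiWeight hα hβ hg)
    (intervalIntegrable_mul_jacobiWeight hα hβ hh)

lemma jacobiIntegral_mono {α β : ℝ} (hα : -1 < α) (hβ : -1 < β) {g h : ℝ → ℝ}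
    (hg : ContinuousOn g (Set.Icc (-1) 1)) (hh : ContinuousOn h (Set.Icc (-1) 1))
    (hgh : ∀ t ∈ Set.Ioo (-1:ℝ) 1, g t ≤ h t) :
    jacobiIntegral α β g ≤ jacobiIntegral α β h :=
  intervalIntegral.integral_mono_on_of_le_Ioo (by norm_num)
    (intervalIntegrable_mul_jacobiWeight hα hβ hg)
    (intervalIntegrable_mul_jacobiWeight hα hβ hh)
    fun t ht => mul_le_mul_of_nonneg_right (hgh t ht) (jacobiWeight_pos α β ht).le

lemma jacobiIntegral_nonneg {α β : ℝ} (hα : -1 < α) (hβ : -1 < β) {g : ℝ → ℝ}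
    (hg : ContinuousOn g (Set.Icc (-1) 1)) (h0 : ∀ t ∈ Set.Ioo (-1:ℝ) 1, 0 ≤ g t) :
    0 ≤ jacobiIntegral α β g := by
  simpa [jacobiIntegral] using jacobiIntegral_mono hα hβ (g := fun _ => 0) continuousOn_const hg h0

lemma abs_jacobiIntegral_le {α β : ℝ} (hα : -1 < α) (hβ : -1 < β) {g h : ℝ → ℝ}
    (hg : ContinuousOn g (Set.Icc (-1) 1)) (hh : ContinuousOn h (Set.Icc (-1) 1))
    (hgh : ∀ t ∈ Set.Ioo (-1:ℝ) 1, |g t| ≤ h t) :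
    |jacobiIntegral α β g| ≤ jacobiIntegral α β h := by
  have hneg : jacobiIntegral α β (fun t => -1 * h t) ≤ jacobiIntegral α β g :=
    jacobiIntegral_mono hα hβ (continuousOn_const.mul hh) hg fun t ht => by
      linarith [(abs_le.1 (hgh t ht)).1]
  rw [jacobiIntegral_const_mul] at hneg
  exact abs_le.2 ⟨by linarith,
    jacobiIntegral_mono hα hβ hg hh fun t ht => (abs_le.1 (hgh t ht)).2⟩

lemma eqOn_zero_of_jacobiIntegral_eq_zero {α β : ℝ} (hα : -1 < α) (hβ : -1 < β) {g : ℝ → ℝ}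
    (hg : ContinuousOn g (Set.Icc (-1) 1)) (h0 : ∀ t ∈ Set.Icc (-1:ℝ) 1, 0 ≤ g t)
    (hint : jacobiIntegral α β g = 0) : Set.EqOn g 0 (Set.Icc (-1) 1) := by
  have hnn : 0 ≤ᵐ[volume.restrict (Set.Ioc (-1:ℝ) 1)] fun t => g t * jacobiWeight α β t := by
    refine (ae_restrict_iff' measurableSet_Ioc).2 (Filter.Eventually.of_forall fun t ht => ?_)
    exact mul_nonneg (h0 t (Set.Ioc_subset_Icc_self ht))
      (jacobiWeight_nonneg α β (Set.Ioc_subset_Icc_self ht))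
  have hae := (intervalIntegral.integral_eq_zero_iff_of_le_of_nonneg_ae (by norm_num) hnn
    (intervalIntegrable_mul_jacobiWeight hα hβ hg)).1 hint
  rw [Filter.EventuallyEq, ← Measure.restrict_congr_set Ioo_ae_eq_Ioc] at hae
  refine Measure.eqOn_Icc_of_ae_eq volume (by norm_num) ?_ hg continuousOn_const
  rw [Filter.EventuallyEq, ← Measure.restrict_congr_set Ioo_ae_eq_Icc]
  filter_upwards [hae, ae_restrict_mem measurableSet_Ioo] with t ht htm
  exact (mul_eq_zero.1 ht).resolve_right (jacobiWeight_pos α β htm).ne'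

lemma Polynomial.continuousOn_eval (p : ℝ[X]) (s : Set ℝ) : ContinuousOn (fun t => p.eval t) s :=
  p.continuous.continuousOn

/-- The Jacobi moment functional on polynomials. -/
noncomputable def jacobiFunctional {α β : ℝ} (hα : -1 < α) (hβ : -1 < β) : ℝ[X] →ₗ[ℝ] ℝ where
  toFun p := jacobiIntegral α β fun t => p.eval t
  map_add' p q := by
    simpa using jacobiIntegral_add hα hβ (p.continuousOn_eval _) (q.continuousOn_eval _)
  map_smul' c p := by simpa using jacobiIntegral_const_mul α β c fun t => p.eval t

lemma jacobiFunctional_apply {α β : ℝ} (hα : -1 < α) (hβ : -1 < β) (p : ℝ[X]) :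
    jacobiFunctional hα hβ p = jacobiIntegral α β fun t => p.eval t := rfl

lemma jacobiFunctional_nonneg {α β : ℝ} (hα : -1 < α) (hβ : -1 < β) {p : ℝ[X]}
    (hp : ∀ t ∈ Set.Ioo (-1:ℝ) 1, 0 ≤ p.eval t) : 0 ≤ jacobiFunctional hα hβ p :=
  jacobiIntegral_nonneg hα hβ (p.continuousOn_eval _) hp

lemma jacobiFunctional_pos {α β : ℝ} (hα : -1 < α) (hβ : -1 < β) {p : ℝ[X]}
    (hp : ∀ t ∈ Set.Icc (-1:ℝ) 1, 0 ≤ p.eval t) (hne : p ≠ 0) :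
    0 < jacobiFunctional hα hβ p := by
  refine (jacobiFunctional_nonneg hα hβ fun t ht =>
    hp t (Set.Ioo_subset_Icc_self ht)).lt_of_ne' fun h0 => hne ?_
  refine Polynomial.eq_zero_of_infinite_isRoot p
    ((Set.Icc_infinite (by norm_num : (-1:ℝ) < 1)).mono ?_)
  exact fun t ht =>
    eqOn_zero_of_jacobiIntegral_eq_zero hα hβ (p.continuousOn_eval _) hp h0 ht

lemma jacobiFunctional_mul_self_pos {α β : ℝ} (hα : -1 < α) (hβ : -1 < β) {p : ℝ[X]}
    (hp : p ≠ 0) : 0 < jacobiFunctional hα hβ (p * p) :=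
  jacobiFunctional_pos hα hβ (fun t _ => by simpa using mul_self_nonneg _) (mul_self_ne_zero.2 hp)

/-- Integration by parts: the total derivative of `(1-t)^(α+1) (1+t)^(β+1) W(t)`. -/
lemma jacobiFunctional_pearson {α β : ℝ} (hα : -1 < α) (hβ : -1 < β) (W : ℝ[X]) :
    jacobiFunctional hα hβ
      ((1 - X ^ 2) * derivative W + (C (β - α) - C (α + β + 2) * X) * W) = 0 := by
  set V : ℝ → ℝ := fun t => (1 - t) ^ (α + 1) * (1 + t) ^ (β + 1) * W.eval t with hV
  have hcont : ContinuousOn V (Set.Icc (-1) 1) := by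
    refine ContinuousOn.mul (ContinuousOn.mul ?_ ?_) (W.continuousOn_eval _)
    · exact ContinuousOn.rpow_const (by fun_prop) fun t _ => Or.inr (by linarith)
    · exact ContinuousOn.rpow_const (by fun_prop) fun t _ => Or.inr (by linarith)
  have hderiv : ∀ t ∈ Set.Ioo (-1:ℝ) 1, HasDerivAt V
      (((1 - X ^ 2) * derivative W + (C (β - α) - C (α + β + 2) * X) * W).eval t
        * jacobiWeight α β t) t := by
    intro t ht
    have h1 : (1:ℝ) - t ≠ 0 := by linarith [ht.2]
    have h2 : (1:ℝ) + t ≠ 0 := by linarith [ht.1]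
    have d1 := ((hasDerivAt_id t).const_sub 1).rpow_const (p := α + 1) (Or.inl h1)
    have d2 := ((hasDerivAt_id t).const_add 1).rpow_const (p := β + 1) (Or.inl h2)
    refine ((d1.mul d2).mul (W.hasDerivAt t)).congr_deriv ?_
    simp only [id, add_sub_cancel_right, Real.rpow_add_one h1, Real.rpow_add_one h2, jacobiWeight,
      eval_add, eval_mul, eval_sub, eval_one, eval_pow, eval_X, eval_C, Pi.mul_apply]
    ring
  rw [jacobiFunctional_apply, jacobiIntegral,
    intervalIntegral.integral_eq_sub_of_hasDerivAt_of_le (by norm_num) hcont hderiv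
      (intervalIntegrable_mul_jacobiWeight hα hβ (Polynomial.continuousOn_eval _ _))]
  simp [hV, Real.zero_rpow (by linarith : α + 1 ≠ 0), Real.zero_rpow (by linarith : β + 1 ≠ 0)]

/-- A functional that kills `p * X ^ j` for `j < n` kills `p * q` for all `q` of degree `< n`. -/
lemma map_mul_eq_zero_of_degree_lt (Λ : ℝ[X] →ₗ[ℝ] ℝ) {n : ℕ} {p : ℝ[X]}
    (hp : ∀ j < n, Λ (p * X ^ j) = 0) {q : ℝ[X]} (hq : q.degree < n) : Λ (p * q) = 0 := by
  rw [q.as_sum_support_C_mul_X_pow, Finset.mul_sum, map_sum]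
  refine Finset.sum_eq_zero fun j hj => ?_
  have hjn : j < n := by exact_mod_cast (le_degree_of_mem_supp j hj).trans_lt hq
  rw [mul_left_comm, ← smul_eq_C_mul, map_smul, hp j hjn, smul_zero]

/-- The Jacobi differential operator on polynomials. -/
noncomputable def jacobiOperator (α β : ℝ) (y : ℝ[X]) : ℝ[X] :=
  (1 - X ^ 2) * derivative (derivative y) + (C (β - α) - C (α + β + 2) * X) * derivative y

lemma coeff_jacobiOperator (α β : ℝ) (y : ℝ[X]) (j : ℕ) :
    (jacobiOperator α β y).coeff j = (j + 1) * (j + 2) * y.coeff (j + 2)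
      + (β - α) * (j + 1) * y.coeff (j + 1) - j * (j + α + β + 1) * y.coeff j := by
  have hrw : jacobiOperator α β y = derivative (derivative y) - X ^ 2 * derivative (derivative y)
      + C (β - α) * derivative y - C (α + β + 2) * (X * derivative y) := by
    unfold jacobiOperator; ring
  rw [hrw]
  simp only [coeff_add, coeff_sub, coeff_C_mul, coeff_derivative]
  rcases j with _ | _ | j
  · simp
    ring
  · simp [coeff_X_pow_mul', coeff_X_mul, coeff_derivative]
    ring
  · simp only [coeff_X_pow_mul, coeff_X_mul, coeff_derivative]
    push_cast
    ring

lemma degree_jacobiOperator_lt {α β : ℝ} {n : ℕ} {q : ℝ[X]} (hq : q.degree < n) :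
    (jacobiOperator α β q).degree < n := by
  rw [degree_lt_iff_coeff_zero] at hq ⊢
  intro j hj
  rw [coeff_jacobiOperator, hq j hj, hq (j + 1) (by omega), hq (j + 2) (by omega)]
  ring

lemma jacobiFunctional_jacobiOperator_mul {α β : ℝ} (hα : -1 < α) (hβ : -1 < β) (y q : ℝ[X]) :
    jacobiFunctional hα hβ (jacobiOperator α β y * q)
      = jacobiFunctional hα hβ (y * jacobiOperator α β q) := by
  rw [← sub_eq_zero, ← map_sub,
    ← jacobiFunctional_pearson hα hβ (derivative y * q - y * derivative q)]
  congr 1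
  simp only [jacobiOperator, derivative_sub, derivative_mul]
  ring

/-- The Jacobi differential equation. -/
lemma jacobiOperator_add_eq_zero {α β : ℝ} (hα : -1 < α) (hβ : -1 < β) {n : ℕ} {y : ℝ[X]}
    (hy : y.natDegree ≤ n) (horth : ∀ j < n, jacobiFunctional hα hβ (y * X ^ j) = 0) :
    jacobiOperator α β y + C (n * (n + α + β + 1)) * y = 0 := by
  set R := jacobiOperator α β y + C (n * (n + α + β + 1)) * y with hR
  have hdeg : R.degree < n := by
    rw [degree_lt_iff_coeff_zero]
    intro j hj
    have h0 : ∀ i, n < i → y.coeff i = 0 := fun i hi =>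
      coeff_eq_zero_of_natDegree_lt (hy.trans_lt hi)
    rw [hR, coeff_add, coeff_C_mul, coeff_jacobiOperator, h0 (j + 1) (by omega),
      h0 (j + 2) (by omega)]
    rcases hj.eq_or_lt with rfl | hj
    · ring
    · rw [h0 j hj]
      ring
  by_contra hne
  refine (jacobiFunctional_mul_self_pos hα hβ hne).ne' ?_
  conv_lhs => rw [hR, add_mul, map_add, ← hR, jacobiFunctional_jacobiOperator_mul, mul_assoc,
    ← smul_eq_C_mul, map_smul, map_mul_eq_zero_of_degree_lt _ horth hdeg,
    map_mul_eq_zero_of_degree_lt _ horth (degree_jacobiOperator_lt hdeg)]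
  simp

/-- Recursion for the Taylor coefficients at `1` of a solution of the Jacobi equation. -/
lemma taylor_one_coeff_succ {α β m : ℝ} {y : ℝ[X]}
    (hy : jacobiOperator α β y + C (m * (m + α + β + 1)) * y = 0) (j : ℕ) :
    2 * (j + 1) * (j + α + 1) * (taylor 1 y).coeff (j + 1)
      = (m - j) * (m + j + α + β + 1) * (taylor 1 y).coeff j := by
  have h := congrArg (fun p => coeff p j) (congrArg (fun p => comp p (X + C 1)) hy)
  have hd : ∀ p : ℝ[X], (derivative p).comp (X + C 1) = derivative (p.comp (X + C 1)) := by
    intro p; simp [derivative_comp]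
  simp only [jacobiOperator, add_comp, mul_comp, sub_comp, one_comp, pow_comp, X_comp, C_comp, hd,
    zero_comp, coeff_zero] at h
  rw [taylor_apply]
  set z := y.comp (X + C 1)
  have hrw : (1 - (X + C 1) ^ 2) * derivative (derivative z)
      + (C (β - α) - C (α + β + 2) * (X + C 1)) * derivative z + C (m * (m + α + β + 1)) * z
      = - (X ^ 2 * derivative (derivative z)) - C 2 * (X * derivative (derivative z))
        - C (2 * (α + 1)) * derivative z - C (α + β + 2) * (X * derivative z)
        + C (m * (m + α + β + 1)) * z := by
    simp only [map_mul, map_add, map_sub, map_one, map_ofNat]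
    ring
  rw [hrw] at h
  simp only [coeff_add, coeff_sub, coeff_neg, coeff_C_mul, coeff_derivative] at h
  rcases j with _ | _ | j
  · simp at h ⊢
    linarith
  · simp [coeff_X_pow_mul', coeff_X_mul, coeff_derivative] at h ⊢
    linarith
  · simp only [coeff_X_pow_mul, coeff_X_mul, coeff_derivative] at h
    push_cast at h ⊢
    linarith

/-- Recursion for the Taylor coefficients at `-1` of a solution of the Jacobi equation. -/
lemma taylor_neg_one_coeff_succ {α β m : ℝ} {y : ℝ[X]}
    (hy : jacobiOperator α β y + C (m * (m + α + β + 1)) * y = 0) (j : ℕ) :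
    2 * (j + 1) * (j + β + 1) * (taylor (-1) y).coeff (j + 1)
      = -((m - j) * (m + j + α + β + 1) * (taylor (-1) y).coeff j) := by
  have h := congrArg (fun p => coeff p j) (congrArg (fun p => comp p (X + C (-1))) hy)
  have hd : ∀ p : ℝ[X], (derivative p).comp (X + C (-1)) = derivative (p.comp (X + C (-1))) := by
    intro p; simp only [derivative_comp, derivative_add, derivative_X, derivative_C, add_zero,
      one_mul]
  simp only [jacobiOperator, add_comp, mul_comp, sub_comp, one_comp, pow_comp, X_comp, C_comp, hd,
    zero_comp, coeff_zero] at h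
  rw [taylor_apply]
  set z := y.comp (X + C (-1))
  have hrw : (1 - (X + C (-1)) ^ 2) * derivative (derivative z)
      + (C (β - α) - C (α + β + 2) * (X + C (-1))) * derivative z + C (m * (m + α + β + 1)) * z
      = - (X ^ 2 * derivative (derivative z)) + C 2 * (X * derivative (derivative z))
        + C (2 * (β + 1)) * derivative z - C (α + β + 2) * (X * derivative z)
        + C (m * (m + α + β + 1)) * z := by
    simp only [map_mul, map_add, map_sub, map_neg, map_one, map_ofNat]
    ring
  rw [hrw] at h
  simp only [coeff_add, coeff_sub, coeff_neg, coeff_C_mul, coeff_derivative] at h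
  rcases j with _ | _ | j
  · simp at h ⊢
    linarith
  · simp [coeff_X_pow_mul', coeff_X_mul, coeff_derivative] at h ⊢
    linarith
  · simp only [coeff_X_pow_mul, coeff_X_mul, coeff_derivative] at h
    push_cast at h ⊢
    linarith

lemma taylor_coeff_natDegree_eq (r : ℝ) (y : ℝ[X]) :
    (taylor r y).coeff y.natDegree = y.leadingCoeff := by
  have h := leadingCoeff_taylor r y
  rwa [leadingCoeff, natDegree_taylor] at h

lemma jacobi_indicial_pos {α β : ℝ} (hα : -1 < α) (hβ : -1 < β) {n j : ℕ} (hj : j < n) :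
    0 < ((n:ℝ) - j) * (n + j + α + β + 1) := by
  have h1 : (j:ℝ) + 1 ≤ n := by exact_mod_cast hj
  have h0 : (0:ℝ) ≤ j := by positivity
  exact mul_pos (by linarith) (by linarith)

lemma leadingCoeff_pos_of_jacobi {α β : ℝ} (hα : -1 < α) (hβ : -1 < β) {n : ℕ} {y : ℝ[X]}
    (hn : y.natDegree = n) (hy : jacobiOperator α β y + C (n * (n + α + β + 1)) * y = 0)
    (h1 : 0 < y.eval 1) : 0 < y.leadingCoeff := by
  have key : ∀ j ≤ n, 0 < (taylor 1 y).coeff j := by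
    intro j
    induction j with
    | zero => intro _; simpa [taylor_coeff_zero] using h1
    | succ j ih =>
      intro hj
      have hpos := mul_pos (jacobi_indicial_pos hα hβ (Nat.lt_of_succ_le hj)) (ih (by omega))
      rw [← taylor_one_coeff_succ hy j] at hpos
      have h0 : (0:ℝ) ≤ j := by positivity
      exact (pos_iff_pos_of_mul_pos hpos).1 (by
        have : 0 < (j:ℝ) + α + 1 := by linarith
        positivity)
  rw [← taylor_coeff_natDegree_eq 1 y, hn]
  exact key n le_rfl

lemma abs_eval_neg_one_le_of_jacobi {α β : ℝ} (hβ : -1 < β) (hβα : β ≤ α) {n : ℕ} {y : ℝ[X]}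
    (hn : y.natDegree = n) (hy : jacobiOperator α β y + C (n * (n + α + β + 1)) * y = 0) :
    |y.eval (-1)| ≤ |y.eval 1| := by
  have key : |(taylor (-1) y).coeff 0| ≤ |(taylor 1 y).coeff 0| := by
    refine Nat.decreasingInduction
      (motive := fun j _ => |(taylor (-1) y).coeff j| ≤ |(taylor 1 y).coeff j|) (n := n)
      (fun j hj ih => ?_) ?_ (Nat.zero_le n)
    · have hμ := jacobi_indicial_pos (hβ.trans_le hβα) hβ hj
      have h0 : (0:ℝ) ≤ j := by positivity
      have e1 := congrArg abs (taylor_one_coeff_succ hy j)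
      have e2 := congrArg abs (taylor_neg_one_coeff_succ hy j)
      have p1 : 0 ≤ 2 * ((j:ℝ) + 1) * (j + α + 1) := mul_nonneg (by positivity) (by linarith)
      have p2 : 0 ≤ 2 * ((j:ℝ) + 1) * (j + β + 1) := mul_nonneg (by positivity) (by linarith)
      rw [abs_mul, abs_of_nonneg p1, abs_mul, abs_of_pos hμ] at e1
      rw [abs_mul, abs_of_nonneg p2, abs_neg, abs_mul, abs_of_pos hμ] at e2
      refine le_of_mul_le_mul_left ?_ hμ
      rw [← e1, ← e2]
      gcongr
    · rw [← hn, taylor_coeff_natDegree_eq, taylor_coeff_natDegree_eq]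
  simpa [taylor_coeff_zero] using key

/-- For `α ≥ β` and `α ≥ -1/2`, Jacobi polynomials attain their maximum modulus at `1`. -/
lemma abs_eval_le_abs_eval_one_of_jacobi {α β : ℝ} (hβ : -1 < β) (hβα : β ≤ α)
    (hα : -(1/2 : ℝ) ≤ α) {n : ℕ} {y : ℝ[X]} (hn : y.natDegree = n)
    (hy : jacobiOperator α β y + C (n * (n + α + β + 1)) * y = 0) {t : ℝ}
    (ht : t ∈ Set.Icc (-1:ℝ) 1) : |y.eval t| ≤ |y.eval 1| := by
  rcases Nat.eq_zero_or_pos n with h0 | hnpos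
  · rw [eq_C_of_natDegree_eq_zero (hn.trans h0)]
    simp
  have hlam : 0 < (n:ℝ) * (n + α + β + 1) := by
    have : (1:ℝ) ≤ n := by exact_mod_cast hnpos
    exact mul_pos (by linarith) (by linarith)
  set lam := (n:ℝ) * (n + α + β + 1) with hlamdef
  set S : ℝ[X] := C lam * y ^ 2 + (1 - X ^ 2) * derivative y ^ 2 with hS
  set g : ℝ → ℝ := fun s => α - β + (α + β + 1) * s with hg
  have hode : ∀ s, (1 - s ^ 2) * (derivative (derivative y)).eval s
      + (β - α - (α + β + 2) * s) * (derivative y).eval s + lam * y.eval s = 0 := fun s => by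
    simpa [jacobiOperator] using congrArg (eval s) hy
  have hder : ∀ s, HasDerivAt (fun x => S.eval x) (2 * (derivative y).eval s ^ 2 * g s) s := by
    intro s
    refine (S.hasDerivAt s).congr_deriv ?_
    simp only [hS, hg, derivative_add, derivative_mul, derivative_C, derivative_pow,
      derivative_sub, derivative_one, derivative_X, eval_add, eval_mul, eval_sub, eval_pow,
      eval_X, eval_C, eval_one, eval_zero]
    norm_num
    linear_combination 2 * (derivative y).eval s * hode s
  have hSt : lam * y.eval t ^ 2 ≤ S.eval t := by
    have : 0 ≤ 1 - t ^ 2 := by nlinarith [ht.1, ht.2]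
    simp only [hS, eval_add, eval_mul, eval_sub, eval_pow, eval_X, eval_C, eval_one]
    nlinarith [mul_nonneg this (sq_nonneg ((derivative y).eval t))]
  have hS1 : S.eval 1 = lam * y.eval 1 ^ 2 := by simp [hS]
  have hSm : S.eval (-1) = lam * y.eval (-1) ^ 2 := by simp [hS]
  have hends := sq_le_sq.2 (abs_eval_neg_one_le_of_jacobi hβ hβα hn hy)
  refine sq_le_sq.1 (le_of_mul_le_mul_left ?_ hlam)
  rcases ht.2.eq_or_lt with rfl | ht1
  · exact le_rfl
  rcases le_or_gt 0 (g t) with hgt | hgt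
  · have hmono : MonotoneOn (fun x => S.eval x) (Set.Icc t 1) := by
      refine monotoneOn_of_deriv_nonneg (convex_Icc t 1) (S.continuousOn_eval _)
        (fun s _ => (hder s).differentiableAt.differentiableWithinAt) fun s hs => ?_
      rw [interior_Icc] at hs
      rw [(hder s).deriv]
      refine mul_nonneg (by positivity) ?_
      refine nonneg_of_mul_nonneg_right (a := 1 - t) ?_ (by linarith)
      have : (1 - t) * g s = (1 - s) * g t + (s - t) * (2 * α + 1) := by simp only [hg]; ring
      rw [this]
      exact add_nonneg (mul_nonneg (by linarith [hs.2]) hgt)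
        (mul_nonneg (by linarith [hs.1]) (by linarith))
    have := hmono (Set.left_mem_Icc.2 ht.2) (Set.right_mem_Icc.2 ht.2) ht.2
    simp only at this
    linarith
  · have hanti : AntitoneOn (fun x => S.eval x) (Set.Icc (-1) t) := by
      refine antitoneOn_of_deriv_nonpos (convex_Icc (-1) t) (S.continuousOn_eval _)
        (fun s _ => (hder s).differentiableAt.differentiableWithinAt) fun s hs => ?_
      rw [interior_Icc] at hs
      rw [(hder s).deriv]
      refine mul_nonpos_of_nonneg_of_nonpos (by positivity) ?_
      refine nonpos_of_mul_nonpos_right (a := 1 - t) ?_ (by linarith)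
      have : (1 - t) * g s = (1 - s) * g t - (t - s) * (2 * α + 1) := by simp only [hg]; ring
      rw [this]
      have h1 : (1 - s) * g t ≤ 0 :=
        mul_nonpos_of_nonneg_of_nonpos (by linarith [hs.2]) hgt.le
      have h2 : 0 ≤ (t - s) * (2 * α + 1) := mul_nonneg (by linarith [hs.2]) (by linarith)
      linarith
    have := hanti (Set.left_mem_Icc.2 ht.1) (Set.right_mem_Icc.2 ht.1) ht.1
    simp only at this
    nlinarith

/-- Against `p` of degree `n` orthogonal to lower degrees, a polynomial of degree at most `n` is
seen only through its coefficient of order `n`. -/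
lemma map_mul_eq_coeff_div (Λ : ℝ[X] →ₗ[ℝ] ℝ) {n : ℕ} {p : ℝ[X]} (hp0 : p ≠ 0)
    (hpn : p.natDegree = n) (hp : ∀ j < n, Λ (p * X ^ j) = 0) {q : ℝ[X]} (hq : q.natDegree ≤ n) :
    Λ (p * q) = q.coeff n / p.leadingCoeff * Λ (p * p) := by
  set c := q.coeff n / p.leadingCoeff with hc
  have hdeg : (q - C c * p).degree < n := by
    rw [degree_lt_iff_coeff_zero]
    intro j hj
    rw [coeff_sub, coeff_C_mul]
    rcases hj.eq_or_lt with rfl | hj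
    · rw [hc, ← hpn, coeff_natDegree, div_mul_cancel₀ _ (leadingCoeff_ne_zero.2 hp0), sub_self]
    · rw [coeff_eq_zero_of_natDegree_lt (hq.trans_lt hj),
        coeff_eq_zero_of_natDegree_lt (hpn.le.trans_lt hj), mul_zero, sub_zero]
  have h := map_mul_eq_zero_of_degree_lt Λ hp hdeg
  rw [mul_sub, mul_left_comm, ← smul_eq_C_mul, map_sub, map_smul, smul_eq_mul] at h
  linarith

section OrthogonalFamily

variable {Λ : ℝ[X] →ₗ[ℝ] ℝ} {P : ℕ → ℝ[X]}

lemma map_mul_eq_zero_of_ne (hdeg : ∀ k, (P k).natDegree = k)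
    (horth : ∀ k, ∀ j < k, Λ (P k * X ^ j) = 0) {j k : ℕ} (hjk : j ≠ k) :
    Λ (P j * P k) = 0 := by
  rcases hjk.lt_or_gt with h | h
  · rw [mul_comm]
    exact map_mul_eq_zero_of_degree_lt Λ (horth k)
      (degree_le_natDegree.trans_lt (by rw [hdeg]; exact_mod_cast h))
  · exact map_mul_eq_zero_of_degree_lt Λ (horth j)
      (degree_le_natDegree.trans_lt (by rw [hdeg]; exact_mod_cast h))

/-- Finite Fourier expansion of a polynomial in an orthogonal family. -/
lemma eq_sum_orthogonal_family (hdeg : ∀ k, (P k).natDegree = k)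
    (horth : ∀ k, ∀ j < k, Λ (P k * X ^ j) = 0) (hpos : ∀ k, 0 < Λ (P k * P k)) (N : ℕ) :
    ∀ p : ℝ[X], p.degree < N →
      p = ∑ k ∈ Finset.range N, C (Λ (P k * p) / Λ (P k * P k)) * P k := by
  have hne : ∀ k, P k ≠ 0 := fun k h => by simpa [h] using hpos k
  induction N with
  | zero =>
    intro p hp
    simpa using hp
  | succ N ih =>
    intro p hp
    have hpN : p.natDegree ≤ N := natDegree_le_iff_coeff_eq_zero.2 fun j hj =>
      (degree_lt_iff_coeff_zero p (N + 1)).1 hp j hj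
    set c := Λ (P N * p) / Λ (P N * P N) with hc
    have hcc : c = p.coeff N / (P N).leadingCoeff := by
      rw [hc, map_mul_eq_coeff_div Λ (hne N) (hdeg N) (horth N) hpN,
        mul_div_cancel_right₀ _ (hpos N).ne']
    have hlt : (p - C c * P N).degree < N := by
      rw [degree_lt_iff_coeff_zero]
      intro j hj
      rw [coeff_sub, coeff_C_mul]
      rcases hj.eq_or_lt with rfl | hj
      · have : (P N).coeff N = (P N).leadingCoeff := by rw [leadingCoeff, hdeg]
        rw [this, hcc, div_mul_cancel₀ _ (leadingCoeff_ne_zero.2 (hne N)), sub_self]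
      · rw [coeff_eq_zero_of_natDegree_lt (hpN.trans_lt hj),
          coeff_eq_zero_of_natDegree_lt ((hdeg N).le.trans_lt hj), mul_zero, sub_zero]
    rw [Finset.sum_range_succ, ← hc, ← sub_eq_iff_eq_add]
    refine (ih _ hlt).trans (Finset.sum_congr rfl fun k hk => ?_)
    rw [mul_sub, mul_left_comm, ← smul_eq_C_mul c, map_sub, map_smul,
      map_mul_eq_zero_of_ne hdeg horth (Finset.mem_range.1 hk).ne, smul_zero, sub_zero]

lemma map_mul_one_add_X_mul_nonneg (hdeg : ∀ k, (P k).natDegree = k)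
    (hlead : ∀ k, 0 < (P k).leadingCoeff)
    (horth : ∀ k, ∀ j < k, Λ (P k * X ^ j) = 0) (hpos : ∀ k, 0 < Λ (P k * P k))
    (hX : ∀ k, 0 ≤ Λ (P k * ((1 + X) * P k))) (j k : ℕ) :
    0 ≤ Λ (P j * ((1 + X) * P k)) := by
  have key : ∀ j k, k < j → 0 ≤ Λ (P j * ((1 + X) * P k)) := by
    intro j k hkj
    obtain ⟨i, rfl⟩ : ∃ i, j = i + 1 := ⟨j - 1, by omega⟩
    have hnd : ((1 + X) * P k).natDegree ≤ i + 1 := by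
      refine natDegree_mul_le.trans ?_
      have : (1 + X : ℝ[X]).natDegree ≤ 1 := by compute_degree
      rw [hdeg]
      omega
    rw [map_mul_eq_coeff_div Λ (leadingCoeff_ne_zero.1 (hlead _).ne') (hdeg _) (horth _) hnd]
    refine mul_nonneg (div_nonneg ?_ (hlead _).le) (hpos _).le
    rw [add_mul, one_mul, coeff_add, coeff_X_mul,
      coeff_eq_zero_of_natDegree_lt ((hdeg k).le.trans_lt hkj), zero_add]
    rcases (Nat.le_of_lt_succ hkj).eq_or_lt with rfl | h
    · simpa [leadingCoeff, hdeg] using (hlead k).le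
    · rw [coeff_eq_zero_of_natDegree_lt ((hdeg k).le.trans_lt h)]
  rcases lt_trichotomy k j with h | rfl | h
  · exact key j k h
  · exact hX k
  · have := key k j h
    rwa [show P k * ((1 + X) * P j) = P j * ((1 + X) * P k) by ring] at this

/-- The powers of `1 + X` have nonnegative coefficients in the orthogonal family. -/
lemma map_mul_one_add_X_pow_nonneg (hdeg : ∀ k, (P k).natDegree = k)
    (hlead : ∀ k, 0 < (P k).leadingCoeff)
    (horth : ∀ k, ∀ j < k, Λ (P k * X ^ j) = 0) (hpos : ∀ k, 0 < Λ (P k * P k))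
    (hX : ∀ k, 0 ≤ Λ (P k * ((1 + X) * P k))) (n : ℕ) :
    ∀ k, 0 ≤ Λ (P k * (1 + X) ^ n) := by
  induction n with
  | zero =>
    intro k
    rw [pow_zero, map_mul_eq_coeff_div Λ (leadingCoeff_ne_zero.1 (hlead _).ne') (hdeg _) (horth _)
      (by simp)]
    refine mul_nonneg (div_nonneg ?_ (hlead _).le) (hpos _).le
    rw [coeff_one]
    split_ifs <;> norm_num
  | succ n ih =>
    intro k
    have hd : ((1 + X) * P k).degree < ((k + 2 : ℕ) : WithBot ℕ) := by
      refine degree_le_natDegree.trans_lt ?_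
      have h1 : (1 + X : ℝ[X]).natDegree ≤ 1 := by compute_degree
      have h2 : ((1 + X) * P k).natDegree ≤ 1 + k :=
        natDegree_mul_le.trans (by rw [hdeg]; omega)
      exact_mod_cast (show ((1 + X) * P k).natDegree < k + 2 by omega)
    rw [show P k * (1 + X) ^ (n + 1) = ((1 + X) * P k) * (1 + X) ^ n by ring,
      eq_sum_orthogonal_family hdeg horth hpos _ _ hd, Finset.sum_mul, map_sum]
    refine Finset.sum_nonneg fun j _ => ?_
    rw [mul_assoc, ← smul_eq_C_mul, map_smul, smul_eq_mul]
    exact mul_nonneg (div_nonneg (map_mul_one_add_X_mul_nonneg hdeg hlead horth hpos hX j k)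
      (hpos j).le) (ih j)

end OrthogonalFamily

lemma jacobiFunctional_one_sub_X_mul_pow {α β : ℝ} (hα : -1 < α) (hβ : -1 < β) (n : ℕ) :
    (n + β + 2) * jacobiFunctional hα hβ ((1 - X) * (1 + X) ^ (n + 1))
      = (α + 1) * jacobiFunctional hα hβ ((1 + X) ^ (n + 2)) := by
  have h := jacobiFunctional_pearson hα hβ ((1 + X) ^ (n + 1))
  have hrw : (1 - X ^ 2) * derivative ((1 + X : ℝ[X]) ^ (n + 1))
      + (C (β - α) - C (α + β + 2) * X) * (1 + X) ^ (n + 1)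
      = (n + β + 2 : ℝ) • ((1 - X) * (1 + X) ^ (n + 1)) - (α + 1) • (1 + X) ^ (n + 2) := by
    simp only [derivative_pow, derivative_one, derivative_X, smul_eq_C_mul,
      map_add, map_sub, map_ofNat, map_natCast, map_one, Nat.add_sub_cancel]
    push_cast
    ring
  rw [hrw, map_sub, map_smul, map_smul, smul_eq_mul, smul_eq_mul] at h
  linarith

lemma jacobiFunctional_one_add_X_pow_pos {α β : ℝ} (hα : -1 < α) (hβ : -1 < β) (n : ℕ) :
    0 < jacobiFunctional hα hβ ((1 + X) ^ n) := by
  refine jacobiFunctional_pos hα hβ (fun t ht => ?_) (pow_ne_zero _ ?_)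
  · have : 0 ≤ 1 + t := by linarith [ht.1]
    simpa using pow_nonneg this n
  · intro h
    simpa using congrArg (eval 0) h

/-- The normalized weights `(1+t)^n` concentrate at `t = 1`. -/
lemma tendsto_jacobiFunctional_mul_one_add_X_pow {α β : ℝ} (hα : -1 < α) (hβ : -1 < β)
    (p : ℝ[X]) :
    Filter.Tendsto (fun n : ℕ => jacobiFunctional hα hβ (p * (1 + X) ^ n)
      / jacobiFunctional hα hβ ((1 + X) ^ n)) Filter.atTop (nhds (p.eval 1)) := by
  obtain ⟨q, hq⟩ := X_sub_C_dvd_sub_C_eval (a := (1:ℝ)) (p := p)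
  obtain ⟨K, hK⟩ := isCompact_Icc.exists_bound_of_continuousOn
    (q.continuousOn_eval (Set.Icc (-1:ℝ) 1))
  have hK0 : 0 ≤ K := (norm_nonneg _).trans (hK 0 (by norm_num))
  rw [← Filter.tendsto_add_atTop_iff_nat 1, tendsto_iff_dist_tendsto_zero]
  refine squeeze_zero (g := fun n : ℕ => (2 * K * (α + 1)) / (n + (β + 2)))
    (fun _ => dist_nonneg) (fun n => ?_)
    ((tendsto_natCast_atTop_atTop.atTop_add tendsto_const_nhds).const_div_atTop _)
  set M := jacobiFunctional hα hβ ((1 + X) ^ (n + 1)) with hM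
  have hM0 : 0 < M := jacobiFunctional_one_add_X_pow_pos hα hβ _
  have hsplit : jacobiFunctional hα hβ (p * (1 + X) ^ (n + 1))
      = p.eval 1 * M + jacobiFunctional hα hβ ((X - C 1) * q * (1 + X) ^ (n + 1)) := by
    rw [← hq, sub_mul, map_sub, ← smul_eq_C_mul, map_smul, smul_eq_mul]
    ring
  have hbound : |jacobiFunctional hα hβ ((X - C 1) * q * (1 + X) ^ (n + 1))|
      ≤ K * jacobiFunctional hα hβ ((1 - X) * (1 + X) ^ (n + 1)) := by
    rw [← smul_eq_mul K, ← map_smul]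
    refine abs_jacobiIntegral_le hα hβ (Polynomial.continuousOn_eval _ _)
      (Polynomial.continuousOn_eval _ _) fun t ht => ?_
    have h1 : 0 ≤ 1 - t := by linarith [ht.2]
    have h2 : 0 ≤ (1 + t) ^ (n + 1) := pow_nonneg (by linarith [ht.1]) _
    have h3 : |q.eval t| ≤ K := hK t (Set.Ioo_subset_Icc_self ht)
    simp only [eval_mul, eval_sub, eval_X, eval_C, eval_pow, eval_add, eval_one, eval_smul,
      smul_eq_mul, abs_mul, abs_of_nonneg h2, abs_sub_comm t 1, abs_of_nonneg h1]
    nlinarith [mul_le_mul_of_nonneg_left h3 (mul_nonneg h1 h2)]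
  have hdouble : jacobiFunctional hα hβ ((1 + X) ^ (n + 2)) ≤ 2 * M := by
    rw [← smul_eq_mul, hM, ← map_smul]
    refine jacobiIntegral_mono hα hβ (Polynomial.continuousOn_eval _ _)
      (Polynomial.continuousOn_eval _ _) fun t ht => ?_
    have h2 : 0 ≤ (1 + t) ^ (n + 1) := pow_nonneg (by linarith [ht.1]) _
    simp only [eval_pow, eval_mul, eval_add, eval_one, eval_X, eval_smul, smul_eq_mul,
      pow_succ _ (n + 1)]
    nlinarith [ht.2]
  have hrec := jacobiFunctional_one_sub_X_mul_pow hα hβ n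
  have hn : 0 < (n:ℝ) + (β + 2) := by
    have : (0:ℝ) ≤ n := by positivity
    linarith
  rw [Real.dist_eq, hsplit, add_div, mul_div_cancel_right₀ _ hM0.ne', add_sub_cancel_left,
    abs_div, abs_of_pos hM0, div_le_div_iff₀ hM0 hn]
  calc _ ≤ K * jacobiFunctional hα hβ ((1 - X) * (1 + X) ^ (n + 1)) * (n + (β + 2)) :=
        mul_le_mul_of_nonneg_right hbound hn.le
    _ = K * (α + 1) * jacobiFunctional hα hβ ((1 + X) ^ (n + 2)) := by linear_combination K * hrec
    _ ≤ K * (α + 1) * (2 * M) :=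
        mul_le_mul_of_nonneg_left hdouble (mul_nonneg hK0 (by linarith))
    _ = _ := by ring

/-- The functional `p ↦ ∫ f p` against the Jacobi weight, for continuous `f`. -/
noncomputable def jacobiPairing {α β : ℝ} (hα : -1 < α) (hβ : -1 < β) {f : ℝ → ℝ}
    (hf : ContinuousOn f (Set.Icc (-1) 1)) : ℝ[X] →ₗ[ℝ] ℝ where
  toFun p := jacobiIntegral α β fun t => f t * p.eval t
  map_add' p q := by
    simpa [mul_add] using jacobiIntegral_add hα hβ (hf.fun_mul (p.continuousOn_eval _))
      (hf.fun_mul (q.continuousOn_eval _))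
  map_smul' c p := by
    simpa [mul_left_comm] using jacobiIntegral_const_mul α β c fun t => f t * p.eval t

lemma jacobiPairing_apply {α β : ℝ} (hα : -1 < α) (hβ : -1 < β) {f : ℝ → ℝ}
    (hf : ContinuousOn f (Set.Icc (-1) 1)) (p : ℝ[X]) :
    jacobiPairing hα hβ hf p = jacobiIntegral α β fun t => f t * p.eval t := rfl

lemma tendsto_jacobiIntegral_mul {α β : ℝ} (hα : -1 < α) (hβ : -1 < β) {F : ℕ → ℝ → ℝ}
    {G g : ℝ → ℝ} (hF : ∀ n, ContinuousOn (F n) (Set.Icc (-1) 1))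
    (hG : ContinuousOn G (Set.Icc (-1) 1)) (hg : ContinuousOn g (Set.Icc (-1) 1))
    (hlim : TendstoUniformlyOn F G Filter.atTop (Set.Icc (-1) 1)) :
    Filter.Tendsto (fun n => jacobiIntegral α β fun t => F n t * g t) Filter.atTop
      (nhds (jacobiIntegral α β fun t => G t * g t)) := by
  set K := jacobiIntegral α β fun t => |g t| with hKdef
  have hK : 0 ≤ K := jacobiIntegral_nonneg hα hβ hg.abs fun t _ => abs_nonneg _
  rw [Metric.tendsto_nhds]
  intro ε hε
  have hδ : 0 < ε / (K + 1) := by positivity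
  filter_upwards [Metric.tendstoUniformlyOn_iff.1 hlim _ hδ] with n hn
  rw [Real.dist_eq, ← jacobiIntegral_sub hα hβ ((hF n).fun_mul hg) (hG.fun_mul hg)]
  have hle := abs_jacobiIntegral_le hα hβ (((hF n).fun_mul hg).fun_sub (hG.fun_mul hg))
    ((continuousOn_const (c := ε / (K + 1))).fun_mul hg.abs) fun t ht => by
      have h := hn t (Set.Ioo_subset_Icc_self ht)
      rw [dist_comm, Real.dist_eq] at h
      rw [show F n t * g t - G t * g t = (F n t - G t) * g t by ring, abs_mul]
      exact mul_le_mul_of_nonneg_right h.le (abs_nonneg _)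
  rw [jacobiIntegral_const_mul, ← hKdef] at hle
  refine hle.trans_lt ?_
  rw [div_mul_eq_mul_div, div_lt_iff₀ (by positivity)]
  nlinarith

/-- A continuous function with vanishing Jacobi moments vanishes. -/
lemma eqOn_zero_of_jacobiIntegral_mul_eval_eq_zero {α β : ℝ} (hα : -1 < α) (hβ : -1 < β)
    {g : ℝ → ℝ} (hg : ContinuousOn g (Set.Icc (-1) 1))
    (h : ∀ p : ℝ[X], jacobiIntegral α β (fun t => p.eval t * g t) = 0) :
    Set.EqOn g 0 (Set.Icc (-1) 1) := by
  choose p hp using fun n : ℕ => exists_polynomial_near_of_continuousOn (-1) 1 g hg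
    (1 / ((n:ℝ) + 1)) (by positivity)
  have hlim : TendstoUniformlyOn (fun n t => (p n).eval t) g Filter.atTop (Set.Icc (-1) 1) := by
    rw [Metric.tendstoUniformlyOn_iff]
    intro ε hε
    filter_upwards [tendsto_one_div_add_atTop_nhds_zero_nat.eventually (gt_mem_nhds hε)]
      with n hn t ht
    rw [dist_comm, Real.dist_eq]
    exact (hp n t ht).trans hn
  have hzero := tendsto_jacobiIntegral_mul hα hβ (fun n => (p n).continuousOn_eval _) hg hg hlim
  simp only [h] at hzero
  have hsq := eqOn_zero_of_jacobiIntegral_eq_zero hα hβ (hg.mul hg)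
    (fun t _ => mul_self_nonneg (g t)) (tendsto_nhds_unique hzero tendsto_const_nhds)
  exact fun t ht => mul_self_eq_zero.1 (hsq ht)

lemma jacobiCoeff_eq_jacobiIntegral (α β : ℝ) (p : ℝ[X]) (f : ℝ → ℝ) :
    jacobiCoeff α β p f = jacobiIntegral α β fun t => f t * p.eval t := by
  simp only [jacobiCoeff, jacobiIntegral, jacobiWeight, mul_assoc]

lemma jacobiNormSq_eq_jacobiFunctional {α β : ℝ} (hα : -1 < α) (hβ : -1 < β) (p : ℝ[X]) :
    jacobiNormSq α β p = jacobiFunctional hα hβ (p * p) := by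
  simp only [jacobiNormSq, jacobiFunctional_apply, jacobiIntegral, jacobiWeight, mul_assoc,
    eval_mul, sq]

/-- Partial sums at `t = 1` of the Fourier series of a nonnegative function are nonnegative once
all omitted coefficients are nonpositive. -/
lemma sum_jacobiFourier_eval_one_nonneg {α β : ℝ} (hα : -1 < α) (hβ : -1 < β) {P : ℕ → ℝ[X]}
    (hdeg : ∀ k, (P k).natDegree = k) (hlead : ∀ k, 0 < (P k).leadingCoeff)
    (horth : ∀ k, ∀ j < k, jacobiFunctional hα hβ (P k * X ^ j) = 0) {f : ℝ → ℝ}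
    (hf : ContinuousOn f (Set.Icc (-1) 1)) (hf0 : ∀ t ∈ Set.Ioo (-1:ℝ) 1, 0 ≤ f t) {N : ℕ}
    (hneg : ∀ k, N ≤ k → jacobiCoeff α β (P k) f ≤ 0) :
    0 ≤ ∑ k ∈ Finset.range N,
      jacobiCoeff α β (P k) f / jacobiNormSq α β (P k) * (P k).eval 1 := by
  set Λ := jacobiFunctional hα hβ with hΛ
  have hpos : ∀ k, 0 < Λ (P k * P k) := fun k =>
    jacobiFunctional_mul_self_pos hα hβ (leadingCoeff_ne_zero.1 (hlead k).ne')
  have hX : ∀ k, 0 ≤ Λ (P k * ((1 + X) * P k)) := fun k =>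
    jacobiFunctional_nonneg hα hβ fun t ht => by
      have : 0 ≤ 1 + t := by linarith [ht.1]
      simp only [eval_mul, eval_add, eval_one, eval_X]
      nlinarith [mul_nonneg this (mul_self_nonneg ((P k).eval t))]
  have hlim : Filter.Tendsto (fun n : ℕ => ∑ k ∈ Finset.range N,
      jacobiCoeff α β (P k) f / jacobiNormSq α β (P k)
        * (Λ (P k * (1 + X) ^ n) / Λ ((1 + X) ^ n))) Filter.atTop
      (nhds (∑ k ∈ Finset.range N,
        jacobiCoeff α β (P k) f / jacobiNormSq α β (P k) * (P k).eval 1)) :=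
    tendsto_finsetSum _ fun k _ =>
      (tendsto_jacobiFunctional_mul_one_add_X_pow hα hβ (P k)).const_mul _
  refine ge_of_tendsto hlim ?_
  filter_upwards [Filter.eventually_ge_atTop N] with n hn
  have hM := jacobiFunctional_one_add_X_pow_pos hα hβ n
  have hd : ((1 + X : ℝ[X]) ^ n).degree < ((n + 1 : ℕ) : WithBot ℕ) := by
    refine degree_le_natDegree.trans_lt ?_
    have h1 : (1 + X : ℝ[X]).natDegree ≤ 1 := by compute_degree
    have h2 := natDegree_pow_le_of_le n h1
    exact_mod_cast (show ((1 + X : ℝ[X]) ^ n).natDegree < n + 1 by omega)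
  have hfull : 0 ≤ ∑ k ∈ Finset.range (n + 1),
      Λ (P k * (1 + X) ^ n) / Λ (P k * P k) * jacobiCoeff α β (P k) f := by
    have h : 0 ≤ jacobiPairing hα hβ hf ((1 + X) ^ n) :=
      jacobiIntegral_nonneg hα hβ (hf.mul (Polynomial.continuousOn_eval _ _)) fun t ht => by
        have : 0 ≤ 1 + t := by linarith [ht.1]
        simpa using mul_nonneg (hf0 t ht) (pow_nonneg this n)
    rw [eq_sum_orthogonal_family hdeg horth hpos _ _ hd, map_sum] at h
    simpa only [← smul_eq_C_mul, map_smul, smul_eq_mul, jacobiPairing_apply,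
      ← jacobiCoeff_eq_jacobiIntegral] using h
  have hle : ∑ k ∈ Finset.range (n + 1),
      Λ (P k * (1 + X) ^ n) / Λ (P k * P k) * jacobiCoeff α β (P k) f
      ≤ ∑ k ∈ Finset.range N,
        Λ (P k * (1 + X) ^ n) / Λ (P k * P k) * jacobiCoeff α β (P k) f := by
    refine Finset.sum_le_sum_of_subset_of_nonpos' (Finset.range_mono (by omega))
      fun k _ hk => ?_
    exact mul_nonpos_of_nonneg_of_nonpos
      (div_nonneg (map_mul_one_add_X_pow_nonneg hdeg hlead horth hpos hX n k) (hpos k).le)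
      (hneg k (by simpa using hk))
  have := div_nonneg (hfull.trans hle) hM.le
  rw [Finset.sum_div] at this
  refine this.trans_eq (Finset.sum_congr rfl fun k _ => ?_)
  rw [jacobiNormSq_eq_jacobiFunctional hα hβ, ← hΛ]
  ring

/-- **Pointwise, absolute and uniform convergence of the Jacobi–Fourier series of a
function of class `K_{l,∞}`.** Here `P k` is (a positive multiple of) the Jacobi polynomial
`P_k^{(α,β)}`, and `f` is continuous, nonnegative on `(-1,1)`, not identically zero, with
nonpositive Jacobi–Fourier coefficients of all orders `k ≥ l+1`. -/
theorem jacobiFourier_series_of_Kl_infty_converges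
    (α β : ℝ) (hβ : -1 < β) (hβα : β ≤ α) (hα : -(1/2 : ℝ) ≤ α)
    (P : ℕ → Polynomial ℝ)
    (hPdeg : ∀ k, (P k).natDegree = k) (hP1 : ∀ k, 0 < (P k).eval 1)
    (hPorth : ∀ k, ∀ j < k,
      ∫ t in (-1:ℝ)..1, (P k).eval t * t ^ j * (1 - t) ^ α * (1 + t) ^ β = 0)
    (l : ℕ) (f : ℝ → ℝ) (hfc : ContinuousOn f (Set.Icc (-1) 1))
    (hf0 : ∀ t ∈ Set.Ioo (-1:ℝ) 1, 0 ≤ f t)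
    (hfne : ∃ t ∈ Set.Icc (-1:ℝ) 1, f t ≠ 0)
    (hcneg : ∀ k, l + 1 ≤ k → jacobiCoeff α β (P k) f ≤ 0) :
    (∀ t ∈ Set.Icc (-1:ℝ) 1, Summable fun k =>
      |jacobiCoeff α β (P k) f / jacobiNormSq α β (P k) * (P k).eval t|) ∧
    TendstoUniformlyOn
      (fun N t => ∑ k ∈ Finset.range N,
        jacobiCoeff α β (P k) f / jacobiNormSq α β (P k) * (P k).eval t)
      f Filter.atTop (Set.Icc (-1) 1) ∧
    ∀ t ∈ Set.Icc (-1:ℝ) 1, HasSum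
      (fun k => jacobiCoeff α β (P k) f / jacobiNormSq α β (P k) * (P k).eval t) (f t) := by
  have hα1 : -1 < α := by linarith
  set Λ := jacobiFunctional hα1 hβ with hΛ
  set c : ℕ → ℝ := fun k => jacobiCoeff α β (P k) f / jacobiNormSq α β (P k) with hc
  have horth : ∀ k, ∀ j < k, Λ (P k * X ^ j) = 0 := fun k j hj => by
    rw [← hPorth k j hj]
    simp only [hΛ, jacobiFunctional_apply, jacobiIntegral, jacobiWeight, eval_mul, eval_pow,
      eval_X, mul_assoc]
  have hode : ∀ k, jacobiOperator α β (P k) + C (k * (k + α + β + 1)) * P k = 0 := fun k =>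
    jacobiOperator_add_eq_zero hα1 hβ (hPdeg k).le (horth k)
  have hlead : ∀ k, 0 < (P k).leadingCoeff := fun k =>
    leadingCoeff_pos_of_jacobi hα1 hβ (hPdeg k) (hode k) (hP1 k)
  have hpos : ∀ k, 0 < Λ (P k * P k) := fun k =>
    jacobiFunctional_mul_self_pos hα1 hβ (leadingCoeff_ne_zero.1 (hlead k).ne')
  have hsup : ∀ k, ∀ t ∈ Set.Icc (-1:ℝ) 1, |(P k).eval t| ≤ (P k).eval 1 := fun k t ht => by
    simpa [abs_of_pos (hP1 k)] using
      abs_eval_le_abs_eval_one_of_jacobi hβ hβα hα (hPdeg k) (hode k) ht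
  have hcneg' : ∀ k, l + 1 ≤ k → c k ≤ 0 := fun k hk => by
    simp only [hc]
    rw [jacobiNormSq_eq_jacobiFunctional hα1 hβ]
    exact div_nonpos_of_nonpos_of_nonneg (hcneg k hk) (hpos k).le
  have hsum : Summable fun k => |c k| * (P k).eval 1 := by
    rw [← summable_nat_add_iff (l + 1)]
    refine summable_of_sum_range_le (c := ∑ k ∈ Finset.range (l + 1), c k * (P k).eval 1)
      (fun k => mul_nonneg (abs_nonneg _) (hP1 _).le) fun n => ?_
    have h := sum_jacobiFourier_eval_one_nonneg hα1 hβ hPdeg hlead horth hfc hf0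
      (N := l + 1 + n) fun k hk => hcneg k (by omega)
    rw [Finset.sum_range_add] at h
    have hrw : ∑ i ∈ Finset.range n, |c (i + (l + 1))| * (P (i + (l + 1))).eval 1
        = -∑ i ∈ Finset.range n, c (l + 1 + i) * (P (l + 1 + i)).eval 1 := by
      rw [← Finset.sum_neg_distrib]
      refine Finset.sum_congr rfl fun i _ => ?_
      rw [add_comm i, abs_of_nonpos (hcneg' _ (by omega)), neg_mul]
    rw [hrw]
    linarith
  have hle : ∀ k, ∀ t ∈ Set.Icc (-1:ℝ) 1, ‖c k * (P k).eval t‖ ≤ |c k| * (P k).eval 1 :=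
    fun k t ht => by
      rw [Real.norm_eq_abs, abs_mul]
      exact mul_le_mul_of_nonneg_left (hsup k t ht) (abs_nonneg _)
  have habs : ∀ t ∈ Set.Icc (-1:ℝ) 1, Summable fun k => |c k * (P k).eval t| := fun t ht =>
    hsum.of_nonneg_of_le (fun _ => abs_nonneg _) fun k => hle k t ht
  have hunif := tendstoUniformlyOn_tsum_nat hsum hle
  have hScont : ContinuousOn (fun t => ∑' k, c k * (P k).eval t) (Set.Icc (-1) 1) :=
    continuousOn_tsum (fun k => continuousOn_const.mul ((P k).continuousOn_eval _)) hsum hle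
  have hmom : ∀ j, jacobiIntegral α β (fun t => (∑' k, c k * (P k).eval t) * (P j).eval t)
      = jacobiCoeff α β (P j) f := by
    intro j
    have hlim := tendsto_jacobiIntegral_mul hα1 hβ
      (fun n => continuousOn_finsetSum _ fun k _ =>
        continuousOn_const.fun_mul ((P k).continuousOn_eval _))
      hScont ((P j).continuousOn_eval _) hunif
    refine tendsto_nhds_unique hlim (tendsto_const_nhds.congr' ?_)
    filter_upwards [Filter.eventually_gt_atTop j] with n hn
    have hpoly : jacobiIntegral α β
        (fun t => (∑ k ∈ Finset.range n, c k * (P k).eval t) * (P j).eval t)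
        = Λ (∑ k ∈ Finset.range n, c k • (P k * P j)) := by
      rw [hΛ, jacobiFunctional_apply]
      simp only [eval_finsetSum, eval_smul, eval_mul, smul_eq_mul, Finset.sum_mul, mul_assoc]
    rw [hpoly, map_sum, Finset.sum_eq_single_of_mem j (Finset.mem_range.2 hn) fun k _ hk => by
      rw [map_smul, map_mul_eq_zero_of_ne hPdeg horth hk, smul_zero], map_smul, smul_eq_mul]
    simp only [hc]
    rw [jacobiNormSq_eq_jacobiFunctional hα1 hβ, div_mul_cancel₀ _ (hpos j).ne']
  have hdiff := hfc.fun_sub hScont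
  have hzero : ∀ p : ℝ[X], jacobiPairing hα1 hβ hdiff p = 0 := by
    intro p
    have hd : p.degree < ((p.natDegree + 1 : ℕ) : WithBot ℕ) :=
      degree_le_natDegree.trans_lt (by exact_mod_cast Nat.lt_succ_self _)
    rw [eq_sum_orthogonal_family hPdeg horth hpos _ _ hd, map_sum]
    refine Finset.sum_eq_zero fun j _ => ?_
    rw [← smul_eq_C_mul, map_smul, jacobiPairing_apply]
    simp only [sub_mul]
    rw [jacobiIntegral_sub hα1 hβ (hfc.fun_mul ((P j).continuousOn_eval _))
      (hScont.fun_mul ((P j).continuousOn_eval _)), hmom, jacobiCoeff_eq_jacobiIntegral, sub_self,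
      smul_zero]
  have heq : ∀ t ∈ Set.Icc (-1:ℝ) 1, ∑' k, c k * (P k).eval t = f t := fun t ht => by
    have := eqOn_zero_of_jacobiIntegral_mul_eval_eq_zero hα1 hβ hdiff
      (fun p => by simpa only [jacobiPairing_apply, mul_comm] using hzero p) ht
    simp only [Pi.zero_apply, sub_eq_zero] at this
    exact this.symm
  refine ⟨habs, hunif.congr_right heq, fun t ht => ?_⟩
  have h := (habs t ht).of_abs.hasSum
  rwa [heq t ht] at h
end

section
/- Let m ≥ 2 and let p be a positive even integer. Let X ⊂ S^{m-1} ⊂ ℝ^m be a finite antipodal set (X = -X) of cardinality N which is a spherical (p+1)-design, i.e. (1/N) Σ_{x∈X} ψ(x) = ∫_{S^{m-1}} ψ dσ for every polynomial function ψ : ℝ^m → ℝ of degree at most p+1. Let Q be a nonzero real polynomial of degree p+1 with ∫_{-1}^{1} Q(s) s^j (1-s²)^{(m-1)/2} ds = 0 for all integers 0 ≤ j ≤ p, and let η be the largest real root of Q (all roots of Q lie in (-1,1)). Then N ≥ 2 · (∫_0^1 (1-s²)^{(m-3)/2} ds) / (∫_η^1 (1-s²)^{(m-3)/2} ds). -/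
open MeasureTheory Polynomial

namespace SphericalDesign

/-! ### The Gegenbauer weight and its differential operator -/

/-- The weight `(1 - s²)^{(m-3)/2}` of the zonal part of the sphere `S^{m-1}`. -/
noncomputable def weight (m : ℕ) (s : ℝ) : ℝ := (1 - s ^ 2) ^ (((m : ℝ) - 3) / 2)

/-- The weight `(1 - s²)^{(m-1)/2}`. -/
noncomputable def upperWeight (m : ℕ) (s : ℝ) : ℝ := (1 - s ^ 2) ^ (((m : ℝ) - 1) / 2)

/-- The eigenvalue `k (k + m - 2)` of the Laplacian of `S^{m-1}` in degree `k`. -/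
def eigenvalue (m k : ℕ) : ℝ := (k : ℝ) * ((k : ℝ) + m - 2)

/-- The zonal part `(1 - s²) f'' - (m - 1) s f'` of the Laplacian of `S^{m-1}`. -/
noncomputable def zonalLaplacian (m : ℕ) (f : ℝ[X]) : ℝ[X] :=
  (1 - X ^ 2) * derivative (derivative f) - C ((m : ℝ) - 1) * X * derivative f

lemma one_sub_sq_pos {s : ℝ} (hs : s ∈ Set.Ioo (-1 : ℝ) 1) : 0 < 1 - s ^ 2 := by
  nlinarith [hs.1, hs.2]

lemma weight_pos (m : ℕ) {s : ℝ} (hs : s ∈ Set.Ioo (-1 : ℝ) 1) : 0 < weight m s :=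
  Real.rpow_pos_of_pos (one_sub_sq_pos hs) _

lemma upperWeight_pos (m : ℕ) {s : ℝ} (hs : s ∈ Set.Ioo (-1 : ℝ) 1) : 0 < upperWeight m s :=
  Real.rpow_pos_of_pos (one_sub_sq_pos hs) _

lemma upperWeight_eq (m : ℕ) {s : ℝ} (hs : s ∈ Set.Ioo (-1 : ℝ) 1) :
    upperWeight m s = (1 - s ^ 2) * weight m s := by
  have h : ((m : ℝ) - 1) / 2 = 1 + ((m : ℝ) - 3) / 2 := by ring
  rw [upperWeight, weight, h, Real.rpow_add (one_sub_sq_pos hs), Real.rpow_one]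

lemma continuous_upperWeight {m : ℕ} (hm : 2 ≤ m) : Continuous (upperWeight m) := by
  have h : (2 : ℝ) ≤ m := by exact_mod_cast hm
  exact (by fun_prop : Continuous fun s : ℝ => 1 - s ^ 2).rpow_const
    fun _ => Or.inr (by linarith)

lemma upperWeight_one {m : ℕ} (hm : 2 ≤ m) : upperWeight m 1 = 0 := by
  have h : (2 : ℝ) ≤ m := by exact_mod_cast hm
  rw [upperWeight, one_pow, sub_self, Real.zero_rpow (by linarith)]

lemma upperWeight_neg_one {m : ℕ} (hm : 2 ≤ m) : upperWeight m (-1) = 0 := by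
  simpa [upperWeight] using upperWeight_one hm

lemma hasDerivAt_upperWeight (m : ℕ) {s : ℝ} (hs : s ∈ Set.Ioo (-1 : ℝ) 1) :
    HasDerivAt (upperWeight m) (-((m : ℝ) - 1) * s * weight m s) s := by
  have h : HasDerivAt (fun s : ℝ => 1 - s ^ 2) (-(2 * s)) s := by
    simpa using ((hasDerivAt_id s).pow 2).const_sub 1
  have h2 := h.rpow_const (p := ((m : ℝ) - 1) / 2) (Or.inl (one_sub_sq_pos hs).ne')
  have e : ((m : ℝ) - 1) / 2 - 1 = ((m : ℝ) - 3) / 2 := by ring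
  rw [e] at h2
  refine h2.congr_deriv ?_
  rw [weight]; ring

lemma intervalIntegrable_weight {m : ℕ} (hm : 2 ≤ m) :
    IntervalIntegrable (weight m) volume (-1) 1 := by
  rcases hm.eq_or_lt with rfl | hm
  · refine intervalIntegral.intervalIntegrable_deriv_of_nonneg
      Real.continuous_arcsin.continuousOn (fun s hs => ?_) (fun s hs => ?_)
    · norm_num at hs
      refine (Real.hasDerivAt_arcsin hs.1.ne' hs.2.ne).congr_deriv ?_
      rw [weight, Real.sqrt_eq_rpow, one_div, ← Real.rpow_neg (one_sub_sq_pos hs).le]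
      norm_num
    · norm_num at hs
      exact (weight_pos 2 hs).le
  · have h : (3 : ℝ) ≤ m := by exact_mod_cast hm
    exact ((by fun_prop : Continuous fun s : ℝ => 1 - s ^ 2).rpow_const
      fun _ => Or.inr (by linarith)).intervalIntegrable _ _

lemma intervalIntegrable_eval_mul_weight {m : ℕ} (hm : 2 ≤ m) {b : ℝ}
    (hb : b ∈ Set.Icc (-1 : ℝ) 1) (f : ℝ[X]) :
    IntervalIntegrable (fun s => f.eval s * weight m s) volume b 1 := by
  have h : IntervalIntegrable (weight m) volume b 1 :=
    (intervalIntegrable_weight hm).mono_set (by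
      rw [Set.uIcc_of_le hb.2, Set.uIcc_of_le (by norm_num)]
      exact Set.Icc_subset_Icc_left hb.1)
  exact h.continuousOn_mul f.continuous.continuousOn

lemma integral_eval_mul_pos {a b : ℝ} (hab : a < b) {f : ℝ[X]} (hf : f ≠ 0) {v : ℝ → ℝ}
    (hv : ∀ s ∈ Set.Ioo a b, 0 < v s) (hf0 : ∀ s ∈ Set.Ioo a b, 0 ≤ f.eval s)
    (hi : IntervalIntegrable (fun s => f.eval s * v s) volume a b) :
    0 < ∫ s in a..b, f.eval s * v s := by
  rw [intervalIntegral.integral_of_le hab.le, integral_Ioc_eq_integral_Ioo,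
    setIntegral_pos_iff_support_of_nonneg_ae]
  · have hsub : Set.Ioo a b \ (f.roots.toFinset : Set ℝ) ⊆
        Function.support (fun s => f.eval s * v s) ∩ Set.Ioo a b := by
      rintro s ⟨hs, hr⟩
      refine ⟨mul_ne_zero (fun h0 => hr ?_) (hv s hs).ne', hs⟩
      simpa [hf] using h0
    refine lt_of_lt_of_le ?_ (measure_mono hsub)
    rw [measure_sdiff_null (Finset.measure_zero _ _)]
    simpa using hab
  · filter_upwards [ae_restrict_mem measurableSet_Ioo] with s hs
    exact mul_nonneg (hf0 s hs) (hv s hs).le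
  · exact ((intervalIntegrable_iff_integrableOn_Ioo_of_le hab.le).1 hi)

/-- Green's formula for the zonal Laplacian on `[b, 1]`. -/
lemma integral_zonalLaplacian_mul {m : ℕ} (hm : 2 ≤ m) {b : ℝ} (hb : b ∈ Set.Icc (-1 : ℝ) 1)
    (f g : ℝ[X]) :
    ∫ s in b..1, (zonalLaplacian m f * g).eval s * weight m s =
      -(upperWeight m b * (derivative f * g).eval b) -
        ∫ s in b..1, (derivative f * derivative g).eval s * upperWeight m s := by
  have hi1 := intervalIntegrable_eval_mul_weight hm hb (zonalLaplacian m f * g)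
  have hi2 : IntervalIntegrable
      (fun s => (derivative f * derivative g).eval s * upperWeight m s) volume b 1 :=
    ((derivative f * derivative g).continuous.mul
      (continuous_upperWeight hm)).intervalIntegrable _ _
  have key := intervalIntegral.integral_eq_sub_of_hasDerivAt_of_le
    (f := fun s => upperWeight m s * (derivative f * g).eval s)
    (f' := fun s => (zonalLaplacian m f * g).eval s * weight m s +
      (derivative f * derivative g).eval s * upperWeight m s) hb.2
    ((continuous_upperWeight hm).mul (derivative f * g).continuous).continuousOn
    (fun s hs => ?_) (hi1.add hi2)
  · rw [intervalIntegral.integral_add hi1 hi2, upperWeight_one hm] at key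
    linarith
  · have hs' : s ∈ Set.Ioo (-1 : ℝ) 1 := ⟨hb.1.trans_lt hs.1, hs.2⟩
    refine ((hasDerivAt_upperWeight m hs').mul ((derivative f * g).hasDerivAt s)).congr_deriv ?_
    rw [upperWeight_eq m hs']
    simp [zonalLaplacian]
    ring

lemma integral_zonalLaplacian_mul_comm {m : ℕ} (hm : 2 ≤ m) (f g : ℝ[X]) :
    ∫ s in (-1 : ℝ)..1, (zonalLaplacian m f * g).eval s * weight m s =
      ∫ s in (-1 : ℝ)..1, (zonalLaplacian m g * f).eval s * weight m s := by
  have h : (-1 : ℝ) ∈ Set.Icc (-1 : ℝ) 1 := by norm_num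
  rw [integral_zonalLaplacian_mul hm h, integral_zonalLaplacian_mul hm h,
    upperWeight_neg_one hm, mul_comm (derivative f) (derivative g)]
  ring

lemma eigenvalue_lt {m : ℕ} (hm : 2 ≤ m) {j k : ℕ} (h : j < k) :
    eigenvalue m j < eigenvalue m k := by
  have h2 : (2 : ℝ) ≤ m := by exact_mod_cast hm
  have hjk : (j : ℝ) + 1 ≤ k := by exact_mod_cast h
  have hj : (0 : ℝ) ≤ j := j.cast_nonneg
  unfold eigenvalue
  nlinarith

lemma eigenvalue_ne {m : ℕ} (hm : 2 ≤ m) {j k : ℕ} (h : j ≠ k) :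
    eigenvalue m j ≠ eigenvalue m k := by
  rcases h.lt_or_gt with h | h
  · exact (eigenvalue_lt hm h).ne
  · exact (eigenvalue_lt hm h).ne'

lemma zonalLaplacian_X_pow (m n : ℕ) :
    zonalLaplacian m (X ^ n) =
      C (-eigenvalue m n) * X ^ n + C ((n : ℝ) * (n - 1)) * X ^ (n - 2) := by
  match n with
  | 0 => simp [zonalLaplacian, eigenvalue]
  | 1 =>
    have h2 : (C 2 : ℝ[X]) = 2 := map_ofNat C 2
    simp [zonalLaplacian, eigenvalue, h2]
    ring
  | n + 2 =>
    have h2 : (C 2 : ℝ[X]) = 2 := map_ofNat C 2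
    simp [zonalLaplacian, eigenvalue, h2]
    ring

lemma zonalLaplacian_add (m : ℕ) (f g : ℝ[X]) :
    zonalLaplacian m (f + g) = zonalLaplacian m f + zonalLaplacian m g := by
  simp [zonalLaplacian]; ring

lemma zonalLaplacian_C_mul (m : ℕ) (a : ℝ) (f : ℝ[X]) :
    zonalLaplacian m (C a * f) = C a * zonalLaplacian m f := by
  simp [zonalLaplacian]; ring

lemma degree_C_mul_le (a : ℝ) (f : ℝ[X]) : (C a * f).degree ≤ f.degree := by
  rw [← smul_eq_C_mul]
  exact degree_smul_le a f

lemma exists_zonalLaplacian_add_eq_X_pow {m : ℕ} (hm : 2 ≤ m) (k n : ℕ) (hn : n < k) :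
    ∃ r : ℝ[X], r.degree ≤ n ∧ zonalLaplacian m r + C (eigenvalue m k) * r = X ^ n := by
  induction n using Nat.strong_induction_on with
  | _ n ih =>
    have hne : eigenvalue m k - eigenvalue m n ≠ 0 := sub_ne_zero.2 (eigenvalue_ne hm hn.ne')
    have hstep : ∃ r : ℝ[X], r.degree ≤ n ∧ zonalLaplacian m r + C (eigenvalue m k) * r =
        C ((n : ℝ) * (n - 1)) * X ^ (n - 2) := by
      by_cases h2 : n < 2
      · refine ⟨0, by simp, ?_⟩
        interval_cases n <;> simp [zonalLaplacian]
      · obtain ⟨r, hr, he⟩ := ih (n - 2) (by omega) (by omega)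
        refine ⟨C ((n : ℝ) * (n - 1)) * r, ?_, ?_⟩
        · refine (degree_C_mul_le _ _).trans (hr.trans ?_)
          exact_mod_cast Nat.sub_le n 2
        · rw [zonalLaplacian_C_mul, ← he]; ring
    obtain ⟨r, hr, he⟩ := hstep
    refine ⟨C (eigenvalue m k - eigenvalue m n)⁻¹ * (X ^ n + C (-1) * r), ?_, ?_⟩
    · refine (degree_C_mul_le _ _).trans ((degree_add_le _ _).trans (max_le ?_ ?_))
      · exact degree_X_pow_le n
      · exact (degree_C_mul_le _ _).trans hr
    · have hc : C (eigenvalue m k - eigenvalue m n)⁻¹ *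
          (C (eigenvalue m k) - C (eigenvalue m n)) = (1 : ℝ[X]) := by
        rw [← C_sub, ← C_mul, inv_mul_cancel₀ hne, C_1]
      rw [zonalLaplacian_C_mul, zonalLaplacian_add, zonalLaplacian_C_mul, zonalLaplacian_X_pow,
        ← he]
      simp only [C_neg, C_1]
      linear_combination X ^ n * hc

/-- The monic Gegenbauer polynomial of each degree exists. -/
lemma exists_monic_eigenpolynomial {m : ℕ} (hm : 2 ≤ m) (k : ℕ) :
    ∃ P r : ℝ[X], P = X ^ k + r ∧ r.degree < k ∧
      zonalLaplacian m P = C (-eigenvalue m k) * P := by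
  have h : ∃ r : ℝ[X], r.degree < k ∧ zonalLaplacian m r + C (eigenvalue m k) * r =
        C ((k : ℝ) * (k - 1)) * X ^ (k - 2) := by
    by_cases h2 : k < 2
    · refine ⟨0, by simp [bot_lt_iff_ne_bot], ?_⟩
      interval_cases k <;> simp [zonalLaplacian]
    · obtain ⟨r, hr, he⟩ := exists_zonalLaplacian_add_eq_X_pow hm k (k - 2) (by omega)
      refine ⟨C ((k : ℝ) * (k - 1)) * r, ?_, ?_⟩
      · refine ((degree_C_mul_le _ _).trans hr).trans_lt ?_
        exact_mod_cast (by omega : k - 2 < k)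
      · rw [zonalLaplacian_C_mul, ← he]; ring
  obtain ⟨r, hr, he⟩ := h
  refine ⟨X ^ k + C (-1) * r, C (-1) * r, rfl, (degree_C_mul_le _ _).trans_lt hr, ?_⟩
  rw [zonalLaplacian_add, zonalLaplacian_C_mul, zonalLaplacian_X_pow, ← he]
  simp only [C_neg, C_1]
  ring

/-- The monic eigenpolynomial of degree `k` of the zonal Laplacian. -/
noncomputable def gegenbauer {m : ℕ} (hm : 2 ≤ m) (k : ℕ) : ℝ[X] :=
  (exists_monic_eigenpolynomial hm k).choose

lemma gegenbauer_spec {m : ℕ} (hm : 2 ≤ m) (k : ℕ) :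
    ∃ r : ℝ[X], gegenbauer hm k = X ^ k + r ∧ r.degree < k ∧
      zonalLaplacian m (gegenbauer hm k) = C (-eigenvalue m k) * gegenbauer hm k :=
  (exists_monic_eigenpolynomial hm k).choose_spec

lemma zonalLaplacian_gegenbauer {m : ℕ} (hm : 2 ≤ m) (k : ℕ) :
    zonalLaplacian m (gegenbauer hm k) = C (-eigenvalue m k) * gegenbauer hm k :=
  (gegenbauer_spec hm k).choose_spec.2.2

lemma monic_gegenbauer {m : ℕ} (hm : 2 ≤ m) (k : ℕ) : (gegenbauer hm k).Monic := by
  obtain ⟨r, hP, hr, -⟩ := gegenbauer_spec hm k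
  rw [hP]
  exact monic_X_pow_add hr

lemma natDegree_gegenbauer {m : ℕ} (hm : 2 ≤ m) (k : ℕ) :
    (gegenbauer hm k).natDegree = k := by
  obtain ⟨r, hP, hr, -⟩ := gegenbauer_spec hm k
  rw [hP]
  exact natDegree_eq_of_degree_eq_some (by
    rw [degree_add_eq_left_of_degree_lt (by rwa [degree_X_pow]), degree_X_pow])

lemma gegenbauer_zero {m : ℕ} (hm : 2 ≤ m) : gegenbauer hm 0 = 1 :=
  (monic_gegenbauer hm 0).natDegree_eq_zero.1 (natDegree_gegenbauer hm 0)

/-- The moment recursion satisfied by any functional annihilating the range of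
`zonalLaplacian m + eigenvalue m k`. -/
def MomentRecursion (m k : ℕ) (a : ℕ → ℝ) : Prop :=
  ∀ n, (eigenvalue m k - eigenvalue m n) * a n + (n : ℝ) * (n - 1) * a (n - 2) = 0

lemma MomentRecursion.eq_zero {m k : ℕ} (hm : 2 ≤ m) {a : ℕ → ℝ} (ha : MomentRecursion m k a)
    (n : ℕ) (hn : n < k) : a n = 0 := by
  induction n using Nat.strong_induction_on with
  | _ n ih =>
    have h := ha n
    have h0 : (n : ℝ) * (n - 1) * a (n - 2) = 0 := by
      by_cases h2 : n < 2
      · interval_cases n <;> simp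
      · rw [ih (n - 2) (by omega) (by omega), mul_zero]
    rw [h0, add_zero] at h
    exact (mul_eq_zero.1 h).resolve_left (sub_ne_zero.2 (eigenvalue_ne hm hn.ne'))

lemma MomentRecursion.proportional {m k : ℕ} (hm : 2 ≤ m) {a b : ℕ → ℝ}
    (ha : MomentRecursion m k a) (hb : MomentRecursion m k b) (n : ℕ) :
    b k * a n = a k * b n := by
  induction n using Nat.strong_induction_on with
  | _ n ih =>
    rcases eq_or_ne n k with rfl | hn
    · ring
    have h0 : (n : ℝ) * (n - 1) * (b k * a (n - 2) - a k * b (n - 2)) = 0 := by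
      by_cases h2 : n < 2
      · interval_cases n <;> simp
      · rw [ih (n - 2) (by omega), sub_self, mul_zero]
    have h : (eigenvalue m k - eigenvalue m n) * (b k * a n - a k * b n) = 0 := by
      linear_combination b k * ha n - a k * hb n - h0
    exact sub_eq_zero.1 ((mul_eq_zero.1 h).resolve_left
      (sub_ne_zero.2 (eigenvalue_ne hm hn.symm)))

lemma integral_eval_mul_eq_zero {v : ℝ → ℝ} (hv : IntervalIntegrable v volume (-1) 1) {d : ℕ}
    (h : ∀ n, n < d → ∫ s in (-1 : ℝ)..1, s ^ n * v s = 0) {f : ℝ[X]} (hf : f.degree < d) :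
    ∫ s in (-1 : ℝ)..1, f.eval s * v s = 0 := by
  rcases eq_or_ne f 0 with rfl | hf0
  · simp
  have hfd : f.natDegree < d := (natDegree_lt_iff_degree_lt hf0).2 hf
  simp_rw [eval_eq_sum_range, Finset.sum_mul, mul_assoc]
  rw [intervalIntegral.integral_finsetSum]
  · refine Finset.sum_eq_zero fun i hi => ?_
    rw [intervalIntegral.integral_const_mul, h i (by simp at hi; omega), mul_zero]
  · exact fun i _ => (hv.continuousOn_mul (continuous_pow i).continuousOn).const_mul _

/-- The moments of the Gegenbauer polynomial of degree `k`. -/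
noncomputable def gegenbauerMoment {m : ℕ} (hm : 2 ≤ m) (k n : ℕ) : ℝ :=
  ∫ s in (-1 : ℝ)..1, s ^ n * ((gegenbauer hm k).eval s * weight m s)

lemma intervalIntegrable_gegenbauer_mul_weight {m : ℕ} (hm : 2 ≤ m) (k : ℕ) :
    IntervalIntegrable (fun s => (gegenbauer hm k).eval s * weight m s) volume (-1) 1 :=
  intervalIntegrable_eval_mul_weight hm (by norm_num) _

lemma momentRecursion_gegenbauerMoment {m : ℕ} (hm : 2 ≤ m) (k : ℕ) :
    MomentRecursion m k (gegenbauerMoment hm k) := by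
  intro n
  have h := integral_zonalLaplacian_mul_comm hm (X ^ n) (gegenbauer hm k)
  have hi (j : ℕ) : IntervalIntegrable
      (fun s => s ^ j * ((gegenbauer hm k).eval s * weight m s)) volume (-1) 1 :=
    (intervalIntegrable_gegenbauer_mul_weight hm k).continuousOn_mul (continuous_pow j).continuousOn
  have h1 (s : ℝ) : (zonalLaplacian m (X ^ n) * gegenbauer hm k).eval s * weight m s =
      -eigenvalue m n * (s ^ n * ((gegenbauer hm k).eval s * weight m s)) +
      (n : ℝ) * (n - 1) * (s ^ (n - 2) * ((gegenbauer hm k).eval s * weight m s)) := by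
    simp only [zonalLaplacian_X_pow, eval_mul, eval_add, eval_C, eval_pow, eval_X]
    ring
  have h2 (s : ℝ) : (zonalLaplacian m (gegenbauer hm k) * X ^ n).eval s * weight m s =
      -eigenvalue m k * (s ^ n * ((gegenbauer hm k).eval s * weight m s)) := by
    simp only [zonalLaplacian_gegenbauer, eval_mul, eval_C, eval_pow, eval_X]
    ring
  simp_rw [h1, h2] at h
  rw [intervalIntegral.integral_add ((hi _).const_mul _) ((hi _).const_mul _)] at h
  simp only [intervalIntegral.integral_const_mul] at h
  simp only [gegenbauerMoment]
  linear_combination h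

lemma gegenbauer_orthogonal {m : ℕ} (hm : 2 ≤ m) (k : ℕ) {f : ℝ[X]} (hf : f.degree < k) :
    ∫ s in (-1 : ℝ)..1, f.eval s * ((gegenbauer hm k).eval s * weight m s) = 0 :=
  integral_eval_mul_eq_zero (intervalIntegrable_gegenbauer_mul_weight hm k)
    (fun n hn => (momentRecursion_gegenbauerMoment hm k).eq_zero hm n hn) hf

lemma gegenbauerMoment_self_ne_zero {m : ℕ} (hm : 2 ≤ m) (k : ℕ) :
    gegenbauerMoment hm k k ≠ 0 := by
  obtain ⟨r, hP, hr, -⟩ := gegenbauer_spec hm k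
  have hi (f : ℝ[X]) : IntervalIntegrable
      (fun s => f.eval s * ((gegenbauer hm k).eval s * weight m s)) volume (-1) 1 :=
    (intervalIntegrable_gegenbauer_mul_weight hm k).continuousOn_mul f.continuous.continuousOn
  have hpos : 0 < ∫ s in (-1 : ℝ)..1, (gegenbauer hm k * gegenbauer hm k).eval s * weight m s :=
    integral_eval_mul_pos (by norm_num)
      (mul_ne_zero (monic_gegenbauer hm k).ne_zero (monic_gegenbauer hm k).ne_zero)
      (fun s hs => weight_pos m hs) (fun s _ => by rw [eval_mul]; exact mul_self_nonneg _)
      (intervalIntegrable_eval_mul_weight hm (by norm_num) _)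
  have h1 (s : ℝ) : (gegenbauer hm k * gegenbauer hm k).eval s * weight m s =
      (X ^ k : ℝ[X]).eval s * ((gegenbauer hm k).eval s * weight m s) +
      r.eval s * ((gegenbauer hm k).eval s * weight m s) := by
    rw [eval_mul, ← add_mul, ← eval_add, ← hP, mul_assoc]
  simp_rw [h1] at hpos
  rw [intervalIntegral.integral_add (hi _) (hi _), gegenbauer_orthogonal hm k hr, add_zero] at hpos
  simp only [eval_pow, eval_X] at hpos
  exact hpos.ne'

lemma derivative_gegenbauer_orthogonal {m : ℕ} (hm : 2 ≤ m) (k j : ℕ) (hj : j + 1 < k) :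
    ∫ s in (-1 : ℝ)..1,
      s ^ j * ((derivative (gegenbauer hm k)).eval s * upperWeight m s) = 0 := by
  have h := integral_zonalLaplacian_mul hm (b := -1) (by norm_num) (gegenbauer hm k)
    (C ((j : ℝ) + 1)⁻¹ * X ^ (j + 1))
  have hj1 : (j : ℝ) + 1 ≠ 0 := by positivity
  rw [upperWeight_neg_one hm] at h
  have h1 (s : ℝ) : (zonalLaplacian m (gegenbauer hm k) *
      (C ((j : ℝ) + 1)⁻¹ * X ^ (j + 1))).eval s * weight m s =
      -eigenvalue m k * (((C ((j : ℝ) + 1)⁻¹ * X ^ (j + 1))).eval s *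
        ((gegenbauer hm k).eval s * weight m s)) := by
    simp only [zonalLaplacian_gegenbauer, eval_mul, eval_C]
    ring
  have h2 (s : ℝ) : (derivative (gegenbauer hm k) *
      derivative (C ((j : ℝ) + 1)⁻¹ * X ^ (j + 1))).eval s * upperWeight m s =
      s ^ j * ((derivative (gegenbauer hm k)).eval s * upperWeight m s) := by
    simp
    field_simp
  simp_rw [h1, h2, intervalIntegral.integral_const_mul] at h
  rw [gegenbauer_orthogonal hm k] at h
  · linarith
  · refine (degree_C_mul_X_pow_le _ _).trans_lt ?_
    exact_mod_cast hj

/-- A polynomial of degree `n` that is orthogonal to all lower powers for the weight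
`(1 - s²)^{(m-1)/2}` is a multiple of the derivative of the Gegenbauer polynomial. -/
lemma eq_C_mul_derivative_gegenbauer {m : ℕ} (hm : 2 ≤ m) {n : ℕ} {Q : ℝ[X]}
    (hQdeg : Q.natDegree = n)
    (hQ : ∀ j < n, ∫ s in (-1 : ℝ)..1, s ^ j * (Q.eval s * upperWeight m s) = 0) :
    ∃ a : ℝ, Q = C a * derivative (gegenbauer hm (n + 1)) := by
  set G := derivative (gegenbauer hm (n + 1)) with hG
  have hGc : G.coeff n = n + 1 := by
    have h := (monic_gegenbauer hm (n + 1)).coeff_natDegree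
    rw [natDegree_gegenbauer] at h
    rw [hG, coeff_derivative, h, one_mul]
  have hGd : G.natDegree ≤ n := by
    refine (natDegree_derivative_le _).trans ?_
    rw [natDegree_gegenbauer]; simp
  refine ⟨Q.coeff n / (n + 1), ?_⟩
  set R := Q - C (Q.coeff n / (n + 1)) * G with hR
  by_contra hne
  have hR0 : R ≠ 0 := sub_ne_zero.2 hne
  have hRd : R.degree < n := by
    rw [degree_lt_iff_coeff_zero]
    intro j hj
    rw [hR, coeff_sub, coeff_C_mul]
    rcases hj.eq_or_lt with rfl | hj
    · rw [hGc]; field_simp; ring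
    · rw [coeff_eq_zero_of_natDegree_lt (hQdeg.trans_lt hj),
        coeff_eq_zero_of_natDegree_lt (hGd.trans_lt hj), mul_zero, sub_zero]
  have hi (f : ℝ[X]) : IntervalIntegrable (fun s => f.eval s * upperWeight m s) volume (-1) 1 :=
    (f.continuous.mul (continuous_upperWeight hm)).intervalIntegrable _ _
  have h0 := integral_eval_mul_eq_zero (hi R) (d := n) (fun j hj => by
    have h1 (s : ℝ) : s ^ j * (R.eval s * upperWeight m s) =
        s ^ j * (Q.eval s * upperWeight m s) -
        Q.coeff n / (n + 1) * (s ^ j * (G.eval s * upperWeight m s)) := by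
      rw [hR, eval_sub, eval_mul, eval_C]; ring
    have hj' (f : ℝ[X]) : IntervalIntegrable
        (fun s => s ^ j * (f.eval s * upperWeight m s)) volume (-1) 1 :=
      (hi f).continuousOn_mul (continuous_pow j).continuousOn
    simp_rw [h1]
    rw [intervalIntegral.integral_sub (hj' _) ((hj' _).const_mul _),
      intervalIntegral.integral_const_mul, hQ j hj,
      derivative_gegenbauer_orthogonal hm (n + 1) j (by omega)]
    ring) hRd
  have hpos := integral_eval_mul_pos (a := -1) (b := 1) (by norm_num) (mul_ne_zero hR0 hR0)
    (fun s hs => upperWeight_pos m hs) (fun s _ => by rw [eval_mul]; exact mul_self_nonneg _)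
    (hi _)
  simp_rw [eval_mul, mul_assoc] at hpos
  exact hpos.ne' h0

/-- The real zeros of an orthogonal polynomial lie in `(-1, 1)`. -/
lemma root_mem_Ioo {m : ℕ} (hm : 2 ≤ m) {n : ℕ} {Q : ℝ[X]} (hQ0 : Q ≠ 0)
    (hQdeg : Q.natDegree = n)
    (hQ : ∀ j < n, ∫ s in (-1 : ℝ)..1, s ^ j * (Q.eval s * upperWeight m s) = 0)
    {η : ℝ} (hη : Q.eval η = 0) : η ∈ Set.Ioo (-1 : ℝ) 1 := by
  obtain ⟨R, rfl⟩ := dvd_iff_isRoot.2 (show Q.IsRoot η from hη)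
  have hR0 : R ≠ 0 := right_ne_zero_of_mul hQ0
  have hi (f : ℝ[X]) : IntervalIntegrable (fun s => f.eval s * upperWeight m s) volume (-1) 1 :=
    (f.continuous.mul (continuous_upperWeight hm)).intervalIntegrable _ _
  have h0 := integral_eval_mul_eq_zero (hi ((X - C η) * R)) (d := n) hQ (f := R) (by
    rw [natDegree_mul (X_sub_C_ne_zero η) hR0, natDegree_X_sub_C] at hQdeg
    exact (natDegree_lt_iff_degree_lt hR0).1 (by omega))
  have hpos (a : ℝ) (ha : a ≠ 0) (hs : ∀ s ∈ Set.Ioo (-1 : ℝ) 1, 0 ≤ a * (s - η)) : False := by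
    have h := integral_eval_mul_pos (a := -1) (b := 1) (f := C a * ((X - C η) * (R * R)))
      (by norm_num)
      (mul_ne_zero (C_ne_zero.2 ha) (mul_ne_zero (X_sub_C_ne_zero η) (mul_ne_zero hR0 hR0)))
      (fun s hs => upperWeight_pos m hs) (fun s hs' => by
        simp only [eval_mul, eval_C, eval_sub, eval_X]
        rw [← mul_assoc]
        exact mul_nonneg (hs s hs') (mul_self_nonneg _)) (hi _)
    have h1 (s : ℝ) : (C a * ((X - C η) * (R * R))).eval s * upperWeight m s =
        a * (R.eval s * (((X - C η) * R).eval s * upperWeight m s)) := by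
      simp only [eval_mul, eval_C]; ring
    simp_rw [h1] at h
    rw [intervalIntegral.integral_const_mul, h0, mul_zero] at h
    exact h.false
  constructor
  · by_contra! h
    exact hpos 1 one_ne_zero fun s hs => by linarith [hs.1]
  · by_contra! h
    exact hpos (-1) (by norm_num) fun s hs => by linarith [hs.2]

/-! ### Integrals over the cap below the largest critical point -/

lemma integral_cap_gegenbauer {m : ℕ} (hm : 2 ≤ m) (n k : ℕ) {η : ℝ}
    (hη : η ∈ Set.Ioo (-1 : ℝ) 1) (hcrit : (derivative (gegenbauer hm n)).eval η = 0) :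
    -(eigenvalue m n * (gegenbauer hm n).eval η) *
        ∫ s in η..1, (gegenbauer hm k).eval s * weight m s =
      (eigenvalue m n - eigenvalue m k) * ∫ s in η..1,
        ((gegenbauer hm n - C ((gegenbauer hm n).eval η)) * gegenbauer hm k).eval s *
          weight m s := by
  have hη' := Set.Ioo_subset_Icc_self hη
  set ψ := gegenbauer hm n with hψ
  set P := gegenbauer hm k with hP
  set φ := ψ - C (ψ.eval η) with hφ
  have h1 := integral_zonalLaplacian_mul hm hη' ψ P
  have h2 := integral_zonalLaplacian_mul hm hη' P φ
  have hdφ : derivative φ = derivative ψ := by simp [hφ]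
  have hφη : φ.eval η = 0 := by simp [hφ]
  rw [eval_mul, hcrit] at h1
  rw [eval_mul, hφη, hdφ, mul_comm (derivative P)] at h2
  have e1 (s : ℝ) : (zonalLaplacian m ψ * P).eval s * weight m s =
      -eigenvalue m n * ((φ * P).eval s * weight m s) +
        -(eigenvalue m n * ψ.eval η) * (P.eval s * weight m s) := by
    rw [hψ, zonalLaplacian_gegenbauer, ← hψ]
    simp only [hφ, eval_mul, eval_C, eval_sub]
    ring
  have e2 (s : ℝ) : (zonalLaplacian m P * φ).eval s * weight m s =
      -eigenvalue m k * ((φ * P).eval s * weight m s) := by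
    rw [hP, zonalLaplacian_gegenbauer, ← hP]
    simp only [eval_mul, eval_C]
    ring
  have hi (f : ℝ[X]) := intervalIntegrable_eval_mul_weight hm hη' f
  simp_rw [e1] at h1
  simp_rw [e2] at h2
  rw [intervalIntegral.integral_add ((hi _).const_mul _) ((hi _).const_mul _)] at h1
  simp only [intervalIntegral.integral_const_mul] at h1 h2
  linear_combination h1 - h2

lemma eval_pos_of_forall_root_le {G : ℝ[X]} (hdeg : 0 < G.degree) (hlead : 0 ≤ G.leadingCoeff)
    {η : ℝ} (hmax : ∀ s, G.eval s = 0 → s ≤ η) {s : ℝ} (hs : η < s) : 0 < G.eval s := by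
  by_contra! hneg
  obtain ⟨u, hu, hsu⟩ := ((G.tendsto_atTop_of_leadingCoeff_nonneg hdeg hlead).eventually_gt_atTop
    0 |>.and (Filter.eventually_ge_atTop s)).exists
  obtain ⟨v, hv, hv0⟩ := intermediate_value_Icc hsu G.continuous.continuousOn ⟨hneg, hu.le⟩
  exact (hs.trans_le hv.1).not_ge (hmax v hv0)

lemma eval_lt_eval_of_derivative_pos {f : ℝ[X]} {η : ℝ}
    (h : ∀ s, η < s → 0 < (derivative f).eval s) {s : ℝ} (hs : η < s) : f.eval η < f.eval s := by
  refine strictMonoOn_of_deriv_pos (convex_Ici η) f.continuous.continuousOn (fun u hu => ?_)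
    Set.self_mem_Ici (Set.mem_Ici.2 hs.le) hs
  rw [interior_Ici] at hu
  rw [Polynomial.deriv]
  exact h u hu

/-! ### Polynomial approximation -/

lemma exists_polynomial_lintegral_sub_le (ρ : Measure ℝ) [IsFiniteMeasure ρ]
    (hρ : ∀ᵐ s ∂ρ, s ∈ Set.Icc (-1 : ℝ) 1) {h : ℝ → ℝ} (hh : MemLp h 1 ρ) {ε : ENNReal}
    (hε : ε ≠ 0) : ∃ f : ℝ[X], ∫⁻ s, ‖h s - f.eval s‖ₑ ∂ρ ≤ ε := by
  rcases eq_or_ne ε ⊤ with rfl | hε'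
  · exact ⟨0, le_top⟩
  obtain ⟨g, hg, -⟩ := hh.exists_boundedContinuous_eLpNorm_sub_le ENNReal.one_ne_top
    (ENNReal.half_pos hε).ne'
  rw [eLpNorm_one_eq_lintegral_enorm] at hg
  have hε2 : 0 < (ε / 2).toReal :=
    ENNReal.toReal_pos (ENNReal.half_pos hε).ne' (ENNReal.div_ne_top hε' (by norm_num))
  have hδ : 0 < (ε / 2).toReal / (ρ.real Set.univ + 1) := by positivity
  obtain ⟨f, hf⟩ := exists_polynomial_near_of_continuousOn (-1) 1 g g.continuous.continuousOn _ hδ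
  have h2 : ∫⁻ s, ‖g s - f.eval s‖ₑ ∂ρ ≤ ε / 2 := by
    calc ∫⁻ s, ‖g s - f.eval s‖ₑ ∂ρ
        ≤ ∫⁻ _, ENNReal.ofReal ((ε / 2).toReal / (ρ.real Set.univ + 1)) ∂ρ := by
          refine lintegral_mono_ae ?_
          filter_upwards [hρ] with s hs
          rw [← ofReal_norm, norm_sub_rev]
          exact ENNReal.ofReal_le_ofReal (hf s hs).le
      _ = ENNReal.ofReal ((ε / 2).toReal / (ρ.real Set.univ + 1) * ρ.real Set.univ) := by
          rw [lintegral_const, ENNReal.ofReal_mul hδ.le, measureReal_def,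
            ENNReal.ofReal_toReal (measure_ne_top _ _)]
      _ ≤ ENNReal.ofReal (ε / 2).toReal := by
          refine ENNReal.ofReal_le_ofReal ?_
          rw [div_mul_eq_mul_div, div_le_iff₀ (by positivity)]
          nlinarith [measureReal_nonneg (μ := ρ) (s := Set.univ)]
      _ = ε / 2 := ENNReal.ofReal_toReal (ENNReal.div_ne_top hε' (by norm_num))
  refine ⟨f, ?_⟩
  calc ∫⁻ s, ‖h s - f.eval s‖ₑ ∂ρ
      ≤ ∫⁻ s, ‖h s - g s‖ₑ + ‖g s - f.eval s‖ₑ ∂ρ := by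
        refine lintegral_mono fun s => ?_
        rw [← sub_add_sub_cancel (h s) (g s) (f.eval s)]
        exact enorm_add_le _ _
    _ = ∫⁻ s, ‖h s - g s‖ₑ ∂ρ + ∫⁻ s, ‖g s - f.eval s‖ₑ ∂ρ :=
        lintegral_add_right _ (by fun_prop)
    _ ≤ ε / 2 + ε / 2 := add_le_add hg h2
    _ = ε := ENNReal.add_halves ε

/-- The distribution of `u` under the total variation of `Y • τ`. -/
noncomputable def absDistribution {Ω : Type*} [MeasurableSpace Ω] (τ : Measure Ω) (u Y : Ω → ℝ) :
    Measure ℝ := (τ.withDensity fun z => ‖Y z‖ₑ).map u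

section Moments

variable {Ω : Type*} [MeasurableSpace Ω] {τ : Measure Ω} {u Y : Ω → ℝ}

lemma isFiniteMeasure_absDistribution (hY : Integrable Y τ) :
    IsFiniteMeasure (absDistribution τ u Y) := by
  have : IsFiniteMeasure (τ.withDensity fun z => ‖Y z‖ₑ) :=
    isFiniteMeasure_withDensity hY.2.ne
  unfold absDistribution
  infer_instance

lemma ae_mem_absDistribution (hu : Measurable u) (hu1 : ∀ᵐ z ∂τ, u z ∈ Set.Icc (-1 : ℝ) 1) :
    ∀ᵐ s ∂absDistribution τ u Y, s ∈ Set.Icc (-1 : ℝ) 1 :=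
  (ae_map_iff hu.aemeasurable measurableSet_Icc).2
    ((withDensity_absolutelyContinuous _ _).ae_le hu1)

lemma enorm_integral_comp_mul_le (hu : Measurable u) (hY : AEMeasurable Y τ) {h : ℝ → ℝ}
    (hh : Measurable h) :
    ‖∫ z, h (u z) * Y z ∂τ‖ₑ ≤ ∫⁻ s, ‖h s‖ₑ ∂absDistribution τ u Y := by
  refine (enorm_integral_le_lintegral_enorm _).trans_eq ?_
  rw [absDistribution, lintegral_map hh.enorm hu,
    lintegral_withDensity_eq_lintegral_mul₀ hY.enorm (g := fun z => ‖h (u z)‖ₑ)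
      (hh.comp hu).enorm.aemeasurable]
  refine lintegral_congr fun z => ?_
  rw [enorm_mul, mul_comm]
  rfl

lemma integrable_comp_mul (hu : Measurable u) (hY : Integrable Y τ) {h : ℝ → ℝ}
    (hh : Measurable h) {B : ℝ} (hB : ∀ᵐ z ∂τ, |h (u z)| ≤ B) :
    Integrable (fun z => h (u z) * Y z) τ :=
  hY.bdd_mul (hh.comp hu).aestronglyMeasurable hB

lemma integrable_eval_comp_mul (hu : Measurable u) (hu1 : ∀ᵐ z ∂τ, u z ∈ Set.Icc (-1 : ℝ) 1)
    (hY : Integrable Y τ) (f : ℝ[X]) : Integrable (fun z => f.eval (u z) * Y z) τ := by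
  obtain ⟨B, hB⟩ := isCompact_Icc.exists_bound_of_continuousOn
    (f.continuous.continuousOn (s := Set.Icc (-1 : ℝ) 1))
  exact integrable_comp_mul hu hY f.continuous.measurable (hu1.mono fun z hz => hB _ hz)

end Moments

/-- If `u₁` and `u₂` have equal moments against `Y₁` and `Y₂`, so do all their bounded measurable
functions. -/
lemma integral_comp_mul_eq_of_moments {Ω₁ Ω₂ : Type*} [MeasurableSpace Ω₁] [MeasurableSpace Ω₂]
    {τ₁ : Measure Ω₁} {τ₂ : Measure Ω₂} {u₁ Y₁ : Ω₁ → ℝ} {u₂ Y₂ : Ω₂ → ℝ}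
    (hu₁ : Measurable u₁) (hu₂ : Measurable u₂)
    (hb₁ : ∀ᵐ z ∂τ₁, u₁ z ∈ Set.Icc (-1 : ℝ) 1) (hb₂ : ∀ᵐ z ∂τ₂, u₂ z ∈ Set.Icc (-1 : ℝ) 1)
    (hY₁ : Integrable Y₁ τ₁) (hY₂ : Integrable Y₂ τ₂)
    (hmom : ∀ n : ℕ, ∫ z, u₁ z ^ n * Y₁ z ∂τ₁ = ∫ z, u₂ z ^ n * Y₂ z ∂τ₂)
    {h : ℝ → ℝ} (hh : Measurable h) {B : ℝ} (hB : ∀ s, |h s| ≤ B) :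
    ∫ z, h (u₁ z) * Y₁ z ∂τ₁ = ∫ z, h (u₂ z) * Y₂ z ∂τ₂ := by
  have := isFiniteMeasure_absDistribution (u := u₁) hY₁
  have := isFiniteMeasure_absDistribution (u := u₂) hY₂
  set ρ := absDistribution τ₁ u₁ Y₁ + absDistribution τ₂ u₂ Y₂ with hρ
  have hpoly (f : ℝ[X]) : ∫ z, f.eval (u₁ z) * Y₁ z ∂τ₁ = ∫ z, f.eval (u₂ z) * Y₂ z ∂τ₂ := by
    induction f using Polynomial.induction_on' with
    | add f g hf hg =>
      simp only [eval_add, add_mul]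
      rw [integral_add (integrable_eval_comp_mul hu₁ hb₁ hY₁ f)
        (integrable_eval_comp_mul hu₁ hb₁ hY₁ g), integral_add
        (integrable_eval_comp_mul hu₂ hb₂ hY₂ f) (integrable_eval_comp_mul hu₂ hb₂ hY₂ g), hf, hg]
    | monomial n a =>
      simp only [eval_monomial, mul_assoc]
      rw [integral_const_mul, integral_const_mul, hmom]
  have hae : ∀ᵐ s ∂ρ, s ∈ Set.Icc (-1 : ℝ) 1 := by
    rw [hρ, ae_add_measure_iff]
    exact ⟨ae_mem_absDistribution hu₁ hb₁, ae_mem_absDistribution hu₂ hb₂⟩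
  have hmem : MemLp h 1 ρ :=
    MemLp.of_bound hh.aestronglyMeasurable B (Filter.Eventually.of_forall hB)
  rw [← sub_eq_zero, ← enorm_eq_zero]
  refine le_antisymm (ENNReal.le_of_forall_pos_le_add fun ε hε _ => ?_) zero_le
  obtain ⟨f, hf⟩ := exists_polynomial_lintegral_sub_le ρ hae hmem (ε := ε)
    (by exact_mod_cast hε.ne')
  have hdiff : ∫ z, h (u₁ z) * Y₁ z ∂τ₁ - ∫ z, h (u₂ z) * Y₂ z ∂τ₂ =
      ∫ z, (h (u₁ z) - f.eval (u₁ z)) * Y₁ z ∂τ₁ -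
        ∫ z, (h (u₂ z) - f.eval (u₂ z)) * Y₂ z ∂τ₂ := by
    simp only [sub_mul]
    rw [integral_sub (integrable_comp_mul hu₁ hY₁ hh (Filter.Eventually.of_forall fun z => hB _))
      (integrable_eval_comp_mul hu₁ hb₁ hY₁ f),
      integral_sub (integrable_comp_mul hu₂ hY₂ hh (Filter.Eventually.of_forall fun z => hB _))
      (integrable_eval_comp_mul hu₂ hb₂ hY₂ f), hpoly f]
    ring
  have hm : Measurable fun s => h s - f.eval s := hh.sub f.continuous.measurable
  rw [hdiff, zero_add]
  calc _ ≤ ‖∫ z, (h (u₁ z) - f.eval (u₁ z)) * Y₁ z ∂τ₁‖ₑ +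
        ‖∫ z, (h (u₂ z) - f.eval (u₂ z)) * Y₂ z ∂τ₂‖ₑ := enorm_sub_le
    _ ≤ ∫⁻ s, ‖h s - f.eval s‖ₑ ∂absDistribution τ₁ u₁ Y₁ +
        ∫⁻ s, ‖h s - f.eval s‖ₑ ∂absDistribution τ₂ u₂ Y₂ :=
      add_le_add (enorm_integral_comp_mul_le hu₁ hY₁.1.aemeasurable hm)
        (enorm_integral_comp_mul_le hu₂ hY₂.1.aemeasurable hm)
    _ = ∫⁻ s, ‖h s - f.eval s‖ₑ ∂ρ := (lintegral_add_measure _ _ _).symm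
    _ ≤ ε := hf

/-! ### Polynomials on the sphere and infinitesimal rotations -/

section Sphere

variable {m : ℕ}

/-- The polynomial function on Euclidean space attached to a multivariate polynomial. -/
noncomputable abbrev polyFun (f : MvPolynomial (Fin m) ℝ) (z : EuclideanSpace ℝ (Fin m)) : ℝ :=
  MvPolynomial.eval (fun k => z k) f

lemma continuous_polyFun (f : MvPolynomial (Fin m) ℝ) : Continuous (polyFun f) :=
  (MvPolynomial.continuous_eval f).comp (by fun_prop)

lemma exists_bound_polyFun (f : MvPolynomial (Fin m) ℝ) :
    ∃ B, ∀ z : EuclideanSpace ℝ (Fin m), ‖z‖ = 1 → |polyFun f z| ≤ B := by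
  obtain ⟨B, hB⟩ := (isCompact_sphere (0 : EuclideanSpace ℝ (Fin m)) 1).exists_bound_of_continuousOn
    (continuous_polyFun f).continuousOn
  exact ⟨B, fun z hz => hB z (by simpa using hz)⟩

/-- The infinitesimal rotation `X i ∂ⱼ - X j ∂ᵢ`. -/
noncomputable def rotDeriv (i j : Fin m) :
    Derivation ℝ (MvPolynomial (Fin m) ℝ) (MvPolynomial (Fin m) ℝ) :=
  (MvPolynomial.X i : MvPolynomial (Fin m) ℝ) • MvPolynomial.pderiv j -
    (MvPolynomial.X j : MvPolynomial (Fin m) ℝ) • MvPolynomial.pderiv i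

lemma rotDeriv_apply (i j : Fin m) (f : MvPolynomial (Fin m) ℝ) :
    rotDeriv i j f = MvPolynomial.X i * MvPolynomial.pderiv j f -
      MvPolynomial.X j * MvPolynomial.pderiv i f := rfl

lemma rotDeriv_self (i : Fin m) (f : MvPolynomial (Fin m) ℝ) : rotDeriv i i f = 0 := by
  rw [rotDeriv_apply, sub_self]

/-- The image of `z` under the rotation by the angle `θ` in the coordinate plane `(i, j)`. -/
noncomputable def rotate (i j : Fin m) (θ : ℝ) (z : EuclideanSpace ℝ (Fin m)) :
    EuclideanSpace ℝ (Fin m) :=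
  z + EuclideanSpace.single i ((Real.cos θ - 1) * z i - Real.sin θ * z j) +
    EuclideanSpace.single j ((Real.cos θ - 1) * z j + Real.sin θ * z i)

lemma norm_rotate {i j : Fin m} (hij : i ≠ j) (θ : ℝ) (z : EuclideanSpace ℝ (Fin m)) :
    ‖rotate i j θ z‖ = ‖z‖ := by
  rw [← sq_eq_sq₀ (norm_nonneg _) (norm_nonneg _), rotate, norm_add_sq_real, norm_add_sq_real]
  simp only [inner_add_left, EuclideanSpace.inner_single_right, PiLp.norm_single]
  simp [hij.symm]
  linear_combination (z i ^ 2 + z j ^ 2) * Real.sin_sq_add_cos_sq θ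

/-- The rotation by the angle `θ` in the coordinate plane `(i, j)`. -/
noncomputable def rotation {i j : Fin m} (hij : i ≠ j) (θ : ℝ) :
    EuclideanSpace ℝ (Fin m) ≃ₗᵢ[ℝ] EuclideanSpace ℝ (Fin m) :=
  LinearIsometry.toLinearIsometryEquiv
    { toFun := rotate i j θ
      map_add' := fun z w => by
        ext k
        simp only [rotate, PiLp.add_apply, PiLp.single_apply]
        split_ifs <;> ring
      map_smul' := fun a z => by
        ext k
        simp only [rotate, PiLp.add_apply, PiLp.smul_apply, PiLp.single_apply,
          smul_eq_mul, RingHom.id_apply]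
        split_ifs <;> ring
      norm_map' := norm_rotate hij θ } rfl

lemma hasDerivAt_polyFun_rotate {i j : Fin m} (hij : i ≠ j) (z : EuclideanSpace ℝ (Fin m))
    (f : MvPolynomial (Fin m) ℝ) (θ : ℝ) :
    HasDerivAt (fun θ => polyFun f (rotate i j θ z)) (polyFun (rotDeriv i j f) (rotate i j θ z))
      θ := by
  induction f using MvPolynomial.induction_on with
  | C a => simpa [polyFun, rotDeriv_apply] using hasDerivAt_const θ a
  | add f g hf hg => simpa only [polyFun, map_add] using hf.fun_add hg
  | mul_X f k hf =>
    have hX : HasDerivAt (fun θ => rotate i j θ z k)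
        (polyFun (rotDeriv i j (MvPolynomial.X k)) (rotate i j θ z)) θ := by
      have hc := Real.hasDerivAt_cos θ
      have hs := Real.hasDerivAt_sin θ
      rcases eq_or_ne k i with rfl | hki
      · have h1 : HasDerivAt (fun θ => z k + ((Real.cos θ - 1) * z k - Real.sin θ * z j))
            (-Real.sin θ * z k - Real.cos θ * z j) θ :=
          ((((hc.sub_const 1).mul_const (z k)).sub (hs.mul_const (z j))).const_add (z k))
        convert! h1 using 1
        · ext θ
          simp [rotate, hij]
        · simp [polyFun, rotDeriv_apply, rotate, MvPolynomial.pderiv_X, hij, hij.symm]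
          ring
      rcases eq_or_ne k j with rfl | hkj
      · have h1 : HasDerivAt (fun θ => z k + ((Real.cos θ - 1) * z k + Real.sin θ * z i))
            (-Real.sin θ * z k + Real.cos θ * z i) θ :=
          ((((hc.sub_const 1).mul_const (z k)).add (hs.mul_const (z i))).const_add (z k))
        convert! h1 using 1
        · ext θ
          simp [rotate, hki]
        · simp [polyFun, rotDeriv_apply, rotate, MvPolynomial.pderiv_X, hij, hij.symm]
          ring
      · convert! hasDerivAt_const θ (z k) using 1
        · ext θ
          simp [rotate, hki, hkj]
        · simp [polyFun, rotDeriv_apply, MvPolynomial.pderiv_X, hki, hkj]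
    have h := hf.mul hX
    convert! h using 1
    · ext θ
      simp [polyFun]
    · simp [polyFun]
      ring

variable {σ : Measure (EuclideanSpace ℝ (Fin m))}

lemma memLp_polyFun [IsFiniteMeasure σ] (hσ : ∀ᵐ z ∂σ, ‖z‖ = 1) (f : MvPolynomial (Fin m) ℝ)
    (q : ENNReal) : MemLp (polyFun f) q σ := by
  obtain ⟨B, hB⟩ := exists_bound_polyFun f
  exact MemLp.of_bound (continuous_polyFun f).aestronglyMeasurable B (hσ.mono hB)

lemma integrable_polyFun [IsFiniteMeasure σ] (hσ : ∀ᵐ z ∂σ, ‖z‖ = 1)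
    (f : MvPolynomial (Fin m) ℝ) : Integrable (polyFun f) σ :=
  memLp_one_iff_integrable.1 (memLp_polyFun hσ f 1)

lemma integral_rotDeriv [IsFiniteMeasure σ] (hσ : ∀ᵐ z ∂σ, ‖z‖ = 1)
    (hinv : ∀ g : EuclideanSpace ℝ (Fin m) ≃ₗᵢ[ℝ] EuclideanSpace ℝ (Fin m), σ.map g = σ)
    (i j : Fin m) (f : MvPolynomial (Fin m) ℝ) : ∫ z, polyFun (rotDeriv i j f) z ∂σ = 0 := by
  rcases eq_or_ne i j with rfl | hij
  · simp [rotDeriv_self, polyFun]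
  obtain ⟨B, hB⟩ := exists_bound_polyFun (rotDeriv i j f)
  have hcont (g : MvPolynomial (Fin m) ℝ) (θ : ℝ) :
      Continuous fun z => polyFun g (rotate i j θ z) :=
    (continuous_polyFun g).comp (rotation hij θ).continuous
  have h0 (z : EuclideanSpace ℝ (Fin m)) : rotate i j 0 z = z := by
    ext k
    simp [rotate]
  have key := (hasDerivAt_integral_of_dominated_loc_of_deriv_le (μ := σ) (x₀ := (0 : ℝ))
    (F := fun θ z => polyFun f (rotate i j θ z))
    (F' := fun θ z => polyFun (rotDeriv i j f) (rotate i j θ z)) (bound := fun _ => B)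
    Filter.univ_mem (Filter.Eventually.of_forall fun θ => (hcont f θ).aestronglyMeasurable)
    (by simpa only [h0] using integrable_polyFun hσ f) (hcont _ 0).aestronglyMeasurable
    (hσ.mono fun z hz θ _ => hB _ (by rw [norm_rotate hij, hz])) (integrable_const B)
    (Filter.Eventually.of_forall fun z θ _ => hasDerivAt_polyFun_rotate hij z f θ)).2
  have hconst : (fun θ => ∫ z, polyFun f (rotate i j θ z) ∂σ) = fun _ => ∫ z, polyFun f z ∂σ := by
    funext θ
    conv_rhs => rw [← hinv (rotation hij θ)]
    rw [integral_map (rotation hij θ).continuous.aemeasurable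
      (continuous_polyFun f).aestronglyMeasurable]
    rfl
  rw [hconst] at key
  simpa only [h0] using key.unique (hasDerivAt_const _ _)

/-- Twice the Laplacian of the sphere, as the sum of the squares of all infinitesimal rotations. -/
noncomputable def rotLaplacian (f : MvPolynomial (Fin m) ℝ) : MvPolynomial (Fin m) ℝ :=
  ∑ i, ∑ j, rotDeriv i j (rotDeriv i j f)

lemma integral_rotLaplacian_mul [IsFiniteMeasure σ] (hσ : ∀ᵐ z ∂σ, ‖z‖ = 1)
    (hinv : ∀ g : EuclideanSpace ℝ (Fin m) ≃ₗᵢ[ℝ] EuclideanSpace ℝ (Fin m), σ.map g = σ)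
    (f g : MvPolynomial (Fin m) ℝ) :
    ∫ z, polyFun (rotLaplacian f * g) z ∂σ =
      -∑ i, ∑ j, ∫ z, polyFun (rotDeriv i j f * rotDeriv i j g) z ∂σ := by
  have h (i j : Fin m) : ∫ z, polyFun (rotDeriv i j (rotDeriv i j f) * g) z ∂σ =
      -∫ z, polyFun (rotDeriv i j f * rotDeriv i j g) z ∂σ := by
    have h1 := integral_rotDeriv hσ hinv i j (rotDeriv i j f * g)
    have h2 (z : EuclideanSpace ℝ (Fin m)) : polyFun (rotDeriv i j (rotDeriv i j f * g)) z =
        polyFun (rotDeriv i j f * rotDeriv i j g) z +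
          polyFun (rotDeriv i j (rotDeriv i j f) * g) z := by
      simp only [polyFun, Derivation.leibniz, smul_eq_mul, map_add, map_mul]
      ring
    simp_rw [h2] at h1
    rw [integral_add (integrable_polyFun hσ _) (integrable_polyFun hσ _)] at h1
    linarith
  simp only [rotLaplacian, Finset.sum_mul, polyFun, map_sum]
  rw [integral_finsetSum _ fun i _ => integrable_finsetSum _ fun j _ => integrable_polyFun hσ _]
  simp_rw [integral_finsetSum _ fun j _ => integrable_polyFun hσ _]
  simp only [← Finset.sum_neg_distrib]
  exact Finset.sum_congr rfl fun i _ => Finset.sum_congr rfl fun j _ => h i j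

lemma integral_rotLaplacian_mul_comm [IsFiniteMeasure σ] (hσ : ∀ᵐ z ∂σ, ‖z‖ = 1)
    (hinv : ∀ g : EuclideanSpace ℝ (Fin m) ≃ₗᵢ[ℝ] EuclideanSpace ℝ (Fin m), σ.map g = σ)
    (f g : MvPolynomial (Fin m) ℝ) :
    ∫ z, polyFun (rotLaplacian f * g) z ∂σ = ∫ z, polyFun (f * rotLaplacian g) z ∂σ := by
  rw [mul_comm f, integral_rotLaplacian_mul hσ hinv, integral_rotLaplacian_mul hσ hinv]
  simp only [mul_comm]

/-- The linear form `∑ xᵢ Xᵢ`. -/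
noncomputable def linearForm (x : EuclideanSpace ℝ (Fin m)) : MvPolynomial (Fin m) ℝ :=
  ∑ i, MvPolynomial.C (x i) * MvPolynomial.X i

lemma polyFun_linearForm (x z : EuclideanSpace ℝ (Fin m)) :
    polyFun (linearForm x) z = inner ℝ x z := by
  simp [linearForm, polyFun, PiLp.inner_apply, mul_comm]

lemma sum_sq_of_norm_eq_one {z : EuclideanSpace ℝ (Fin m)} (hz : ‖z‖ = 1) :
    ∑ i, z i ^ 2 = 1 := by
  rw [← EuclideanSpace.real_norm_sq_eq, hz, one_pow]

lemma pderiv_linearForm (x : EuclideanSpace ℝ (Fin m)) (j : Fin m) :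
    MvPolynomial.pderiv j (linearForm x) = MvPolynomial.C (x j) := by
  simp [linearForm, MvPolynomial.pderiv_X, Pi.single_apply]

lemma sum_rotDeriv_linearForm_sq (x : EuclideanSpace ℝ (Fin m)) (hx : ‖x‖ = 1)
    {z : EuclideanSpace ℝ (Fin m)} (hz : ‖z‖ = 1) :
    ∑ i, ∑ j, polyFun (rotDeriv i j (linearForm x)) z ^ 2 = 2 * (1 - inner ℝ x z ^ 2) := by
  have h (i j : Fin m) : polyFun (rotDeriv i j (linearForm x)) z ^ 2 =
      z i ^ 2 * x j ^ 2 + x i ^ 2 * z j ^ 2 - 2 * ((x i * z i) * (x j * z j)) := by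
    simp only [rotDeriv_apply, pderiv_linearForm, polyFun, map_sub, map_mul, MvPolynomial.eval_X,
      MvPolynomial.eval_C]
    ring
  simp_rw [h, Finset.sum_sub_distrib, Finset.sum_add_distrib, ← Finset.mul_sum, ← Finset.sum_mul,
    sum_sq_of_norm_eq_one hx, sum_sq_of_norm_eq_one hz, PiLp.inner_apply]
  simp only [RCLike.inner_apply, conj_trivial]
  simp only [mul_comm (z.ofLp _)]
  ring

lemma rotLaplacian_linearForm (x : EuclideanSpace ℝ (Fin m)) :
    rotLaplacian (linearForm x) = MvPolynomial.C (-(2 * ((m : ℝ) - 1))) * linearForm x := by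
  have h (i j : Fin m) : rotDeriv i j (rotDeriv i j (linearForm x)) =
      -(MvPolynomial.C (x i) * MvPolynomial.X i + MvPolynomial.C (x j) * MvPolynomial.X j) +
        if i = j then 2 * (MvPolynomial.C (x i) * MvPolynomial.X i) else 0 := by
    simp only [rotDeriv_apply, pderiv_linearForm, map_sub, Derivation.leibniz, smul_eq_mul,
      MvPolynomial.pderiv_X, MvPolynomial.pderiv_C]
    rcases eq_or_ne i j with rfl | hij
    · simp; ring
    · simp [hij, hij.symm]; ring
  simp only [rotLaplacian, h, Finset.sum_add_distrib, Finset.sum_neg_distrib, Finset.sum_const,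
    Finset.sum_ite_eq, Finset.mem_univ, if_true, ← Finset.mul_sum, Finset.card_univ,
    Fintype.card_fin]
  rw [← linearForm, ← Finset.smul_sum, ← linearForm]
  simp
  have h2 : (MvPolynomial.C 2 : MvPolynomial (Fin m) ℝ) = 2 := map_ofNat MvPolynomial.C 2
  rw [h2]
  ring

lemma polyFun_rotLaplacian_linearForm_pow (x : EuclideanSpace ℝ (Fin m)) (hx : ‖x‖ = 1) (n : ℕ)
    {z : EuclideanSpace ℝ (Fin m)} (hz : ‖z‖ = 1) :
    polyFun (rotLaplacian (linearForm x ^ n)) z =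
      -(2 * eigenvalue m n) * inner ℝ x z ^ n +
        2 * ((n : ℝ) * (n - 1)) * inner ℝ x z ^ (n - 2) := by
  have h (i j : Fin m) : polyFun (rotDeriv i j (rotDeriv i j (linearForm x ^ n))) z =
      (n : ℝ) * inner ℝ x z ^ (n - 1) *
          polyFun (rotDeriv i j (rotDeriv i j (linearForm x))) z +
        ((n : ℝ) * (n - 1)) * inner ℝ x z ^ (n - 2) *
          polyFun (rotDeriv i j (linearForm x)) z ^ 2 := by
    rw [← polyFun_linearForm]
    simp only [Derivation.leibniz_pow, Derivation.leibniz, smul_eq_mul, nsmul_eq_mul, polyFun,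
      map_add, map_mul, map_pow, map_natCast, Derivation.map_natCast, map_zero]
    rcases n with _ | n
    · simp
    · simp only [Nat.add_sub_cancel, Nat.cast_add, Nat.cast_one,
        show n + 1 - 2 = n - 1 by omega]
      ring
  have h1 : ∑ i, ∑ j, polyFun (rotDeriv i j (rotDeriv i j (linearForm x))) z =
      -(2 * ((m : ℝ) - 1)) * inner ℝ x z := by
    have := congrArg (fun f => polyFun f z) (rotLaplacian_linearForm x)
    simpa [rotLaplacian, polyFun, ← polyFun_linearForm] using this
  have h2 : polyFun (rotLaplacian (linearForm x ^ n)) z =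
      ∑ i, ∑ j, polyFun (rotDeriv i j (rotDeriv i j (linearForm x ^ n))) z := by
    simp [rotLaplacian, polyFun]
  rw [h2, Finset.sum_congr rfl fun i _ => Finset.sum_congr rfl fun j _ => h i j]
  simp only [Finset.sum_add_distrib, ← Finset.mul_sum]
  rw [h1, sum_rotDeriv_linearForm_sq x hx hz, eigenvalue]
  clear h h1 h2
  rcases n with _ | _ | n
  · simp
  · simp only [Nat.cast_add, Nat.cast_one, Nat.cast_zero]
    ring
  · simp only [Nat.cast_add, Nat.cast_one, show n + 1 + 1 - 1 = n + 1 by omega,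
      show n + 1 + 1 - 2 = n by omega]
    ring

/-! ### Degrees -/

lemma rotLaplacian_add (f g : MvPolynomial (Fin m) ℝ) :
    rotLaplacian (f + g) = rotLaplacian f + rotLaplacian g := by
  simp [rotLaplacian, Finset.sum_add_distrib]

lemma rotLaplacian_sum {ι : Type*} (s : Finset ι) (f : ι → MvPolynomial (Fin m) ℝ) :
    rotLaplacian (∑ a ∈ s, f a) = ∑ a ∈ s, rotLaplacian (f a) :=
  map_sum (AddMonoidHom.mk' rotLaplacian rotLaplacian_add) f s

lemma pderiv_comm (i j : Fin m) (f : MvPolynomial (Fin m) ℝ) :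
    MvPolynomial.pderiv i (MvPolynomial.pderiv j f) =
      MvPolynomial.pderiv j (MvPolynomial.pderiv i f) := by
  have hX (a b k : Fin m) : MvPolynomial.pderiv a (MvPolynomial.pderiv b
      (MvPolynomial.X k : MvPolynomial (Fin m) ℝ)) = 0 := by
    rcases eq_or_ne k b with rfl | h
    · simp
    · simp [MvPolynomial.pderiv_X_of_ne h]
  induction f using MvPolynomial.induction_on with
  | C a => simp
  | add f g hf hg => simp only [map_add, hf, hg]
  | mul_X f k hf =>
    simp only [Derivation.leibniz, map_add, smul_eq_mul, hX, hf]
    ring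

/-- The Laplacian of the sphere in polar form, on a homogeneous polynomial. -/
lemma rotLaplacian_of_isHomogeneous {f : MvPolynomial (Fin m) ℝ} {d : ℕ} (hf : f.IsHomogeneous d) :
    rotLaplacian f = MvPolynomial.C (-(2 * eigenvalue m d)) * f +
      2 * ((∑ i, MvPolynomial.X i ^ 2) *
        ∑ j, MvPolynomial.pderiv j (MvPolynomial.pderiv j f)) := by
  have hE := hf.sum_X_mul_pderiv
  have hE2 : ∑ i, MvPolynomial.X i * ∑ j, MvPolynomial.X j *
      MvPolynomial.pderiv j (MvPolynomial.pderiv i f) =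
      MvPolynomial.C ((d : ℝ) * (d - 1)) * f := by
    have h (i : Fin m) := (hf.pderiv (i := i)).sum_X_mul_pderiv
    simp_rw [h, mul_smul_comm, ← Finset.smul_sum, hE]
    rcases d with _ | d
    · simp
    · simp
      ring
  have h (i j : Fin m) : rotDeriv i j (rotDeriv i j f) =
      MvPolynomial.X i ^ 2 * MvPolynomial.pderiv j (MvPolynomial.pderiv j f) +
      MvPolynomial.pderiv i (MvPolynomial.pderiv i f) * MvPolynomial.X j ^ 2 -
      2 * (MvPolynomial.X i * (MvPolynomial.X j *
        MvPolynomial.pderiv j (MvPolynomial.pderiv i f))) -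
      (MvPolynomial.X i * MvPolynomial.pderiv i f + MvPolynomial.X j * MvPolynomial.pderiv j f) +
        if i = j then 2 * (MvPolynomial.X i * MvPolynomial.pderiv i f) else 0 := by
    have hc : MvPolynomial.pderiv i (MvPolynomial.pderiv j f) =
        MvPolynomial.pderiv j (MvPolynomial.pderiv i f) := pderiv_comm i j f
    simp only [rotDeriv_apply, map_sub, Derivation.leibniz, smul_eq_mul, MvPolynomial.pderiv_X, hc]
    rcases eq_or_ne i j with rfl | hij
    · simp; ring
    · simp [hij, hij.symm]; ring
  have h2 : (MvPolynomial.C 2 : MvPolynomial (Fin m) ℝ) = 2 := map_ofNat MvPolynomial.C 2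
  simp only [rotLaplacian, h, Finset.sum_add_distrib, Finset.sum_sub_distrib, Finset.sum_const,
    Finset.sum_ite_eq, Finset.mem_univ, if_true, ← Finset.mul_sum, ← Finset.sum_mul,
    Finset.card_univ, Fintype.card_fin, hE, hE2, ← Finset.smul_sum]
  simp [eigenvalue, h2]
  ring

end Sphere


/-! ### Spherical harmonics and the Funk–Hecke formula -/

section FunkHecke

variable {m : ℕ}

lemma exists_polyFun_rotLaplacian_eq {f : MvPolynomial (Fin m) ℝ} {n : ℕ}
    (hf : f.totalDegree ≤ n + 1) {c : ℝ}
    (hc : ∀ d ≤ f.totalDegree, n < d → c = 2 * eigenvalue m d) :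
    ∃ g : MvPolynomial (Fin m) ℝ, g.totalDegree ≤ n ∧
      ∀ z : EuclideanSpace ℝ (Fin m), ‖z‖ = 1 →
        polyFun (rotLaplacian f) z = -c * polyFun f z + polyFun g z := by
  set F : ℕ → MvPolynomial (Fin m) ℝ := fun d => MvPolynomial.homogeneousComponent d f with hF
  have hFhom (d : ℕ) : (F d).IsHomogeneous d := MvPolynomial.homogeneousComponent_isHomogeneous d f
  have hsum : ∑ d ∈ Finset.range (f.totalDegree + 1), F d = f :=
    MvPolynomial.sum_homogeneousComponent f
  refine ⟨∑ d ∈ Finset.range (f.totalDegree + 1), (MvPolynomial.C (c - 2 * eigenvalue m d) * F d +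
    MvPolynomial.C 2 * ∑ j, MvPolynomial.pderiv j (MvPolynomial.pderiv j (F d))), ?_, ?_⟩
  · refine MvPolynomial.totalDegree_finsetSum_le fun d hd => ?_
    have hd' : d ≤ f.totalDegree := Nat.lt_succ_iff.mp (Finset.mem_range.mp hd)
    refine (MvPolynomial.totalDegree_add _ _).trans (max_le ?_ ?_)
    · rcases le_or_gt d n with hdn | hdn
      · refine (MvPolynomial.totalDegree_mul _ _).trans ?_
        rw [MvPolynomial.totalDegree_C, zero_add]
        exact (hFhom d).totalDegree_le.trans hdn
      · simp [hc d hd' hdn]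
    · refine (MvPolynomial.totalDegree_mul _ _).trans ?_
      rw [MvPolynomial.totalDegree_C, zero_add]
      refine MvPolynomial.totalDegree_finsetSum_le fun j _ => ?_
      exact ((hFhom d).pderiv.pderiv).totalDegree_le.trans (by omega)
  · intro z hz
    have hz2 := sum_sq_of_norm_eq_one hz
    conv_lhs => rw [← hsum, rotLaplacian_sum]
    conv_rhs => enter [1]; rw [← hsum]
    simp only [polyFun, map_sum, Finset.mul_sum, ← Finset.sum_add_distrib]
    refine Finset.sum_congr rfl fun d _ => ?_
    rw [rotLaplacian_of_isHomogeneous (hFhom d)]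
    simp only [map_add, map_mul, map_sum, map_pow, MvPolynomial.eval_X, MvPolynomial.eval_C, hz2,
      map_ofNat]
    rw [← Finset.mul_sum]
    ring

variable {σ : Measure (EuclideanSpace ℝ (Fin m))}

/-- A polynomial orthogonal to all polynomials of smaller degree is an eigenfunction of the
Laplacian of the sphere. -/
lemma ae_polyFun_rotLaplacian_eq [IsFiniteMeasure σ] (hσ : ∀ᵐ z ∂σ, ‖z‖ = 1)
    (hinv : ∀ g : EuclideanSpace ℝ (Fin m) ≃ₗᵢ[ℝ] EuclideanSpace ℝ (Fin m), σ.map g = σ)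
    {Y : MvPolynomial (Fin m) ℝ} {n : ℕ} (hY : Y.totalDegree ≤ n + 1)
    (horth : ∀ g : MvPolynomial (Fin m) ℝ, g.totalDegree ≤ n → ∫ z, polyFun (Y * g) z ∂σ = 0) :
    ∀ᵐ z ∂σ, polyFun (rotLaplacian Y) z = -(2 * eigenvalue m (n + 1)) * polyFun Y z := by
  obtain ⟨g, hg, hgY⟩ := exists_polyFun_rotLaplacian_eq (c := 2 * eigenvalue m (n + 1)) hY
    fun d hd hnd => by rw [show d = n + 1 by omega]
  obtain ⟨h, hh, hhg⟩ := exists_polyFun_rotLaplacian_eq (f := g) (c := 0) (n := n) (by omega)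
    fun d hd hnd => by omega
  have hLg : ∫ z, polyFun (rotLaplacian Y * g) z ∂σ = 0 := by
    rw [integral_rotLaplacian_mul_comm hσ hinv, ← horth h hh]
    refine integral_congr_ae ?_
    filter_upwards [hσ] with z hz
    simp only [polyFun, map_mul]
    rw [show MvPolynomial.eval (fun k => z k) (rotLaplacian g) = _ from hhg z hz]
    ring
  have hg0 : ∫ z, polyFun (g * g) z ∂σ = 0 := by
    have : ∫ z, polyFun (g * g) z ∂σ = ∫ z, (polyFun (rotLaplacian Y * g) z +
        2 * eigenvalue m (n + 1) * polyFun (Y * g) z) ∂σ := by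
      refine integral_congr_ae ?_
      filter_upwards [hσ] with z hz
      have := hgY z hz
      simp only [polyFun, map_mul] at this ⊢
      rw [this]
      ring
    rw [this, integral_add (integrable_polyFun hσ _) ((integrable_polyFun hσ _).const_mul _), hLg,
      integral_const_mul, horth g hg, mul_zero, add_zero]
  have hg0' : (fun z => polyFun (g * g) z) =ᵐ[σ] 0 :=
    (integral_eq_zero_iff_of_nonneg (fun z => by
      simp only [polyFun, map_mul]; exact mul_self_nonneg _) (integrable_polyFun hσ _)).mp hg0
  filter_upwards [hσ, hg0'] with z hz hgz
  have : polyFun g z = 0 := by simpa [polyFun] using hgz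
  rw [hgY z hz, this, add_zero]

lemma inner_mem_Icc_of_norm_eq_one {x z : EuclideanSpace ℝ (Fin m)} (hx : ‖x‖ = 1) (hz : ‖z‖ = 1) :
    inner ℝ x z ∈ Set.Icc (-1 : ℝ) 1 := by
  have := abs_real_inner_le_norm x z
  rw [hx, hz, one_mul] at this
  exact abs_le.mp this

/-- The Funk–Hecke formula. -/
lemma funkHecke (hm : 2 ≤ m) [IsFiniteMeasure σ] (hσ : ∀ᵐ z ∂σ, ‖z‖ = 1)
    (hinv : ∀ g : EuclideanSpace ℝ (Fin m) ≃ₗᵢ[ℝ] EuclideanSpace ℝ (Fin m), σ.map g = σ)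
    {Y : MvPolynomial (Fin m) ℝ} {k : ℕ}
    (hY : ∀ᵐ z ∂σ, polyFun (rotLaplacian Y) z = -(2 * eigenvalue m k) * polyFun Y z)
    {x : EuclideanSpace ℝ (Fin m)} (hx : ‖x‖ = 1) {h : ℝ → ℝ} (hh : Measurable h) {B : ℝ}
    (hB : ∀ s, |h s| ≤ B) :
    gegenbauerMoment hm k k * ∫ z, h (inner ℝ x z) * polyFun Y z ∂σ =
      (∫ z, inner ℝ x z ^ k * polyFun Y z ∂σ) *
        ∫ s in (-1 : ℝ)..1, h s * ((gegenbauer hm k).eval s * weight m s) := by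
  have hmoment (n : ℕ) : ∫ z, inner ℝ x z ^ n * polyFun Y z ∂σ =
      ∫ z, polyFun (linearForm x ^ n * Y) z ∂σ := by
    simp only [polyFun, map_mul, map_pow]
    simp_rw [show ∀ z : EuclideanSpace ℝ (Fin m), MvPolynomial.eval (fun k => z k) (linearForm x) =
      inner ℝ x z from polyFun_linearForm x]
  have hintegrable (n : ℕ) : Integrable (fun z => inner ℝ x z ^ n * polyFun Y z) σ := by
    refine (integrable_polyFun hσ (linearForm x ^ n * Y)).congr (ae_of_all _ fun z => ?_)
    simp only [polyFun, map_mul, map_pow]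
    rw [show MvPolynomial.eval (fun k => z k) (linearForm x) = inner ℝ x z from
      polyFun_linearForm x z]
  have hrec : MomentRecursion m k fun n => ∫ z, inner ℝ x z ^ n * polyFun Y z ∂σ := by
    intro n
    have h₁ : ∫ z, polyFun (rotLaplacian (linearForm x ^ n) * Y) z ∂σ =
        -(2 * eigenvalue m n) * (∫ z, inner ℝ x z ^ n * polyFun Y z ∂σ) +
        2 * ((n : ℝ) * (n - 1)) * ∫ z, inner ℝ x z ^ (n - 2) * polyFun Y z ∂σ := by
      rw [← integral_const_mul, ← integral_const_mul,
        ← integral_add ((hintegrable n).const_mul _) ((hintegrable (n - 2)).const_mul _)]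
      refine integral_congr_ae ?_
      filter_upwards [hσ] with z hz
      have := polyFun_rotLaplacian_linearForm_pow x hx n hz
      simp only [polyFun, map_mul] at this ⊢
      rw [this]
      ring
    have h₂ : ∫ z, polyFun (linearForm x ^ n * rotLaplacian Y) z ∂σ =
        -(2 * eigenvalue m k) * ∫ z, inner ℝ x z ^ n * polyFun Y z ∂σ := by
      rw [hmoment, ← integral_const_mul]
      refine integral_congr_ae ?_
      filter_upwards [hY] with z hz
      simp only [polyFun, map_mul] at hz ⊢
      rw [hz]
      ring
    have h₃ := integral_rotLaplacian_mul_comm hσ hinv (linearForm x ^ n) Y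
    rw [h₁, h₂] at h₃
    linear_combination h₃ / 2
  have hgeg := intervalIntegrable_gegenbauer_mul_weight hm k
  rw [intervalIntegrable_iff_integrableOn_Ioc_of_le (by norm_num)] at hgeg
  set a := ∫ z, inner ℝ x z ^ k * polyFun Y z ∂σ with ha
  have key := integral_comp_mul_eq_of_moments (τ₁ := σ) (τ₂ := volume.restrict (Set.Ioc (-1 : ℝ) 1))
    (u₁ := fun z => inner ℝ x z) (u₂ := id)
    (Y₁ := fun z => gegenbauerMoment hm k k * polyFun Y z)
    (Y₂ := fun s => a * ((gegenbauer hm k).eval s * weight m s))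
    (by fun_prop) measurable_id
    (by filter_upwards [hσ] with z hz using inner_mem_Icc_of_norm_eq_one hx hz)
    (by
      filter_upwards [ae_restrict_mem measurableSet_Ioc] with s hs using ⟨hs.1.le, hs.2⟩)
    ((integrable_polyFun hσ Y).const_mul _) (hgeg.const_mul _)
    (fun n => by
      have := MomentRecursion.proportional hm hrec (momentRecursion_gegenbauerMoment hm k) n
      simp only [mul_left_comm _ (gegenbauerMoment hm k k), mul_left_comm _ a, id]
      rw [integral_const_mul, integral_const_mul, this, gegenbauerMoment,
        intervalIntegral.integral_of_le (by norm_num)])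
    hh hB
  simp only [mul_left_comm _ (gegenbauerMoment hm k k), mul_left_comm _ a, id] at key
  rwa [integral_const_mul, integral_const_mul,
    ← intervalIntegral.integral_of_le (by norm_num)] at key

/-- The distribution of a linear form on the sphere. -/
lemma integral_comp_inner (hm : 2 ≤ m) [IsProbabilityMeasure σ] (hσ : ∀ᵐ z ∂σ, ‖z‖ = 1)
    (hinv : ∀ g : EuclideanSpace ℝ (Fin m) ≃ₗᵢ[ℝ] EuclideanSpace ℝ (Fin m), σ.map g = σ)
    {x : EuclideanSpace ℝ (Fin m)} (hx : ‖x‖ = 1) {h : ℝ → ℝ} (hh : Measurable h) {B : ℝ}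
    (hB : ∀ s, |h s| ≤ B) :
    (∫ s in (-1 : ℝ)..1, weight m s) * ∫ z, h (inner ℝ x z) ∂σ =
      ∫ s in (-1 : ℝ)..1, h s * weight m s := by
  have hY : ∀ᵐ z ∂σ, polyFun (rotLaplacian (1 : MvPolynomial (Fin m) ℝ)) z =
      -(2 * eigenvalue m 0) * polyFun 1 z := by
    refine ae_of_all _ fun z => ?_
    simp [polyFun, rotLaplacian, eigenvalue]
  simpa [gegenbauerMoment, gegenbauer_zero, polyFun] using funkHecke hm hσ hinv hY hx hh hB

end FunkHecke

/-! ### An inequality for functions with oppositely signed harmonic components -/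

lemma inner_le_inner_mul_inner_of_filtration {H : Type*} [NormedAddCommGroup H]
    [InnerProductSpace ℝ H] (V : ℕ → Submodule ℝ H) [∀ n, (V n).HasOrthogonalProjection]
    (hV : Monotone V) (hdense : ⊤ ≤ (⨆ n, V n).topologicalClosure) {e : H} (he : ‖e‖ = 1)
    (hV0 : V 0 = Submodule.span ℝ {e}) {T U : H}
    (h : ∀ n, ∃ a ≤ (0 : ℝ), ∀ y ∈ V (n + 1), y ∈ (V n)ᗮ → inner ℝ T y = a * inner ℝ U y) :
    inner ℝ T U ≤ inner ℝ e T * inner ℝ e U := by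
  have hlim : Filter.Tendsto (fun n => inner ℝ T ((V n).starProjection U)) Filter.atTop
      (nhds (inner ℝ T U)) :=
    tendsto_const_nhds.inner (Submodule.starProjection_tendsto_self V hV U hdense)
  have hanti : Antitone fun n => inner ℝ T ((V n).starProjection U) := by
    refine antitone_nat_of_succ_le fun n => ?_
    obtain ⟨a, ha, hTy⟩ := h n
    have hle : V n ≤ V (n + 1) := hV n.le_succ
    set y := (V (n + 1)).starProjection U - (V n).starProjection U with hy
    have hmem : y ∈ V (n + 1) := sub_mem (Submodule.starProjection_apply_mem _ _)
      (hle (Submodule.starProjection_apply_mem _ _))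
    have hperp : y ∈ (V n)ᗮ := by
      refine (Submodule.mem_orthogonal' _ _).mpr fun v hv => ?_
      have h₁ := Submodule.starProjection_inner_eq_zero (K := V n) U v hv
      have h₂ := Submodule.starProjection_inner_eq_zero (K := V (n + 1)) U v (hle hv)
      rw [inner_sub_left] at h₁ h₂ ⊢
      linarith
    have hUy : 0 ≤ inner ℝ U y := by
      have h₁ := Submodule.starProjection_inner_eq_zero (K := V (n + 1)) U y hmem
      have h₂ := (Submodule.mem_orthogonal _ _).mp hperp _
        (Submodule.starProjection_apply_mem (V n) U)
      have h₃ : 0 ≤ inner ℝ y y := real_inner_self_nonneg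
      rw [inner_sub_left] at h₁
      nth_rewrite 1 [hy] at h₃
      rw [inner_sub_left] at h₃
      linarith
    have hTy' := hTy y hmem hperp
    rw [hy, inner_sub_right] at hTy'
    have := mul_nonpos_of_nonpos_of_nonneg ha hUy
    linarith
  have h0 := hanti.le_of_tendsto hlim 0
  have hproj : (V 0).starProjection U = inner ℝ e U • e := by
    simp_rw [hV0]
    exact Submodule.starProjection_unit_singleton ℝ he U
  simp only [hproj, inner_smul_right] at h0
  rw [real_inner_comm T e]
  linarith

section Harmonics

variable {m : ℕ} {σ : Measure (EuclideanSpace ℝ (Fin m))}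

/-- The class in `L²(σ)` of a polynomial function. -/
noncomputable def polyLp [IsFiniteMeasure σ] (hσ : ∀ᵐ z ∂σ, ‖z‖ = 1) :
    MvPolynomial (Fin m) ℝ →ₗ[ℝ] Lp ℝ 2 σ where
  toFun f := (memLp_polyFun hσ f 2).toLp (polyFun f)
  map_add' f g := by
    rw [← MemLp.toLp_add]
    exact MemLp.toLp_congr _ _ (ae_of_all _ fun z => by simp [polyFun])
  map_smul' a f := by
    rw [RingHom.id_apply, ← MemLp.toLp_const_smul]
    exact MemLp.toLp_congr _ _ (ae_of_all _ fun z => by simp [polyFun, MvPolynomial.smul_eval])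

lemma exists_polyFun_near (b : C(EuclideanSpace ℝ (Fin m), ℝ)) {ε : ℝ} (hε : 0 < ε) :
    ∃ f : MvPolynomial (Fin m) ℝ, ∀ z : EuclideanSpace ℝ (Fin m), ‖z‖ = 1 →
      ‖polyFun f z - b z‖ < ε := by
  set coord : Fin m → C(EuclideanSpace ℝ (Fin m), ℝ) := fun i => ⟨fun z => z i, by fun_prop⟩
  have hsep : (MvPolynomial.aeval (R := ℝ) coord).range.SeparatesPoints := by
    intro z w hzw
    obtain ⟨i, hi⟩ : ∃ i, z i ≠ w i := by
      by_contra! hcon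
      exact hzw (by ext i; exact hcon i)
    exact ⟨coord i, ⟨coord i, ⟨MvPolynomial.X i, by simp⟩, rfl⟩, hi⟩
  obtain ⟨_, ⟨f, rfl⟩, hf⟩ :=
    ContinuousMap.exists_mem_subalgebra_near_continuous_of_isCompact_of_separatesPoints hsep b
      (isCompact_sphere (0 : EuclideanSpace ℝ (Fin m)) 1) hε
  refine ⟨f, fun z hz => ?_⟩
  have heval : (MvPolynomial.aeval (R := ℝ) coord f) z = polyFun f z := by
    clear hf
    induction f using MvPolynomial.induction_on with
    | C a => simp [polyFun]
    | add f g hf hg => simp_all [polyFun]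
    | mul_X f i hf => simp_all [polyFun, coord]
  have := hf z (by simpa using hz)
  rwa [← heval]

lemma dense_range_polyLp [IsProbabilityMeasure σ] (hσ : ∀ᵐ z ∂σ, ‖z‖ = 1) :
    DenseRange (polyLp hσ) := by
  intro F
  rw [Metric.mem_closure_iff]
  intro ε hε
  have hε3 : 0 < ε / 3 := by positivity
  obtain ⟨b, hb, hbL⟩ := (Lp.memLp F).exists_boundedContinuous_eLpNorm_sub_le (by simp)
    (ENNReal.ofReal_pos.mpr hε3).ne'
  obtain ⟨f, hf⟩ := exists_polyFun_near b.toContinuousMap hε3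
  refine ⟨polyLp hσ f, ⟨f, rfl⟩, ?_⟩
  have h₁ : dist F (hbL.toLp b) ≤ ε / 3 := by
    rw [← Lp.toLp_coeFn F (Lp.memLp F), Lp.dist_edist, Lp.edist_toLp_toLp]
    exact ENNReal.toReal_le_of_le_ofReal hε3.le hb
  have h₂ : dist (polyLp hσ f) (hbL.toLp b) ≤ ε / 3 := by
    rw [show polyLp hσ f = (memLp_polyFun hσ f 2).toLp (polyFun f) from rfl, Lp.dist_edist,
      Lp.edist_toLp_toLp]
    refine ENNReal.toReal_le_of_le_ofReal hε3.le ((eLpNorm_le_of_ae_bound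
      (C := ε / 3) ?_).trans_eq (by simp))
    filter_upwards [hσ] with z hz using (hf z hz).le
  linarith [dist_triangle_right F (polyLp hσ f) (hbL.toLp b)]

lemma integral_mul_le_of_harmonics [IsProbabilityMeasure σ] (hσ : ∀ᵐ z ∂σ, ‖z‖ = 1)
    {T U : EuclideanSpace ℝ (Fin m) → ℝ} (hT : MemLp T 2 σ) (hU : MemLp U 2 σ)
    (h : ∀ n, ∃ a ≤ (0 : ℝ), ∀ Y : MvPolynomial (Fin m) ℝ, Y.totalDegree ≤ n + 1 →
      (∀ g : MvPolynomial (Fin m) ℝ, g.totalDegree ≤ n → ∫ z, polyFun (Y * g) z ∂σ = 0) →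
      ∫ z, T z * polyFun Y z ∂σ = a * ∫ z, U z * polyFun Y z ∂σ) :
    ∫ z, T z * U z ∂σ ≤ (∫ z, T z ∂σ) * ∫ z, U z ∂σ := by
  have hinner {f g : EuclideanSpace ℝ (Fin m) → ℝ} (hf : MemLp f 2 σ) (hg : MemLp g 2 σ) :
      inner ℝ (hf.toLp f) (hg.toLp g) = ∫ z, f z * g z ∂σ := by
    rw [L2.inner_def]
    refine integral_congr_ae ?_
    filter_upwards [hf.coeFn_toLp, hg.coeFn_toLp] with z hz hz'
    rw [hz, hz', real_inner_comm]
    rfl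
  set V : ℕ → Submodule ℝ (Lp ℝ 2 σ) := fun n =>
    (MvPolynomial.restrictTotalDegree (Fin m) ℝ n).map (polyLp hσ) with hVdef
  have hV : Monotone V := fun i j hij => Submodule.map_mono fun f hf => by
    rw [MvPolynomial.mem_restrictTotalDegree] at hf ⊢
    exact hf.trans hij
  have hdense : ⊤ ≤ (⨆ n, V n).topologicalClosure := by
    intro F _
    refine closure_mono ?_ (dense_range_polyLp hσ F)
    rintro _ ⟨f, rfl⟩
    exact Submodule.mem_iSup_of_mem f.totalDegree (Submodule.mem_map_of_mem
      ((MvPolynomial.mem_restrictTotalDegree _ _ _).mpr le_rfl))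
  have hone (f : EuclideanSpace ℝ (Fin m) → ℝ) (hf : MemLp f 2 σ) :
      inner ℝ (polyLp hσ 1) (hf.toLp f) = ∫ z, f z ∂σ := by
    rw [show polyLp hσ 1 = (memLp_polyFun hσ 1 2).toLp (polyFun 1) from rfl, hinner]
    simp [polyFun]
  have he : ‖polyLp hσ 1‖ = 1 := by
    have : inner ℝ (polyLp hσ 1) (polyLp hσ 1) = (1 : ℝ) := by
      refine (hone (polyFun 1) (memLp_polyFun hσ 1 2)).trans ?_
      simp [polyFun]
    rw [real_inner_self_eq_norm_sq] at this
    nlinarith [norm_nonneg (polyLp hσ 1)]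
  have hV0 : V 0 = Submodule.span ℝ {polyLp hσ 1} := by
    have : MvPolynomial.restrictTotalDegree (Fin m) ℝ 0 = Submodule.span ℝ {1} := by
      ext f
      rw [MvPolynomial.mem_restrictTotalDegree, Submodule.mem_span_singleton, Nat.le_zero,
        MvPolynomial.totalDegree_eq_zero_iff_eq_C]
      constructor
      · intro hf
        exact ⟨MvPolynomial.coeff 0 f, by rw [MvPolynomial.smul_eq_C_mul, mul_one, ← hf]⟩
      · rintro ⟨a, rfl⟩
        simp [MvPolynomial.smul_eq_C_mul]
    rw [hVdef]
    simp only [this, Submodule.map_span, Set.image_singleton]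
  have := inner_le_inner_mul_inner_of_filtration V hV hdense he hV0 (T := hT.toLp T)
    (U := hU.toLp U) fun n => by
      obtain ⟨a, ha, hY⟩ := h n
      refine ⟨a, ha, ?_⟩
      rintro _ ⟨Y, hYdeg, rfl⟩ hperp
      rw [SetLike.mem_coe, MvPolynomial.mem_restrictTotalDegree] at hYdeg
      rw [show polyLp hσ Y = (memLp_polyFun hσ Y 2).toLp (polyFun Y) from rfl, hinner, hinner]
      refine hY Y hYdeg fun g hg => ?_
      have hg' := (Submodule.mem_orthogonal' _ _).mp hperp (polyLp hσ g)
        (Submodule.mem_map_of_mem ((MvPolynomial.mem_restrictTotalDegree _ _ _).mpr hg))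
      simpa [polyFun] using (hinner (memLp_polyFun hσ Y 2) (memLp_polyFun hσ g 2)).symm.trans hg'
  rwa [hinner, hone, hone] at this

end Harmonics

/-! ### Designs and caps -/

section Design

variable {m : ℕ}

/-- The polynomial function `f` truncated to the interval `[η, 1]`. -/
noncomputable def truncEval (η : ℝ) (f : ℝ[X]) : ℝ → ℝ :=
  (Set.Icc η 1).indicator fun s => f.eval s

lemma measurable_truncEval (η : ℝ) (f : ℝ[X]) : Measurable (truncEval η f) :=
  f.continuous.measurable.indicator measurableSet_Icc

lemma exists_bound_truncEval (η : ℝ) (f : ℝ[X]) : ∃ B, ∀ s, |truncEval η f s| ≤ B := by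
  obtain ⟨B, hB⟩ := (isCompact_Icc (a := η) (b := 1)).exists_bound_of_continuousOn
    f.continuous.continuousOn
  refine ⟨max B 0, fun s => ?_⟩
  by_cases hs : s ∈ Set.Icc η 1
  · rw [truncEval, Set.indicator_of_mem hs]
    exact (hB s hs).trans (le_max_left _ _)
  · rw [truncEval, Set.indicator_of_notMem hs, abs_zero]
    exact le_max_right _ _

lemma integral_truncEval_mul {η : ℝ} (hη : η ∈ Set.Icc (-1 : ℝ) 1) (f : ℝ[X]) (v : ℝ → ℝ) :
    ∫ s in (-1 : ℝ)..1, truncEval η f s * v s = ∫ s in η..1, f.eval s * v s := by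
  rw [intervalIntegral.integral_of_le (by norm_num), intervalIntegral.integral_of_le hη.2,
    ← integral_Icc_eq_integral_Ioc, ← integral_Icc_eq_integral_Ioc]
  have : (fun s => truncEval η f s * v s) = (Set.Icc η 1).indicator fun s => f.eval s * v s := by
    ext s
    by_cases hs : s ∈ Set.Icc η 1 <;> simp [truncEval, hs]
  rw [this, setIntegral_indicator measurableSet_Icc,
    Set.inter_eq_right.mpr (Set.Icc_subset_Icc_left hη.1)]

lemma integral_weight_pos (hm : 2 ≤ m) {η : ℝ} (hη : η ∈ Set.Ico (-1 : ℝ) 1) :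
    0 < ∫ s in η..1, weight m s := by
  simpa using integral_eval_mul_pos hη.2 (f := 1) one_ne_zero
    (fun s hs => weight_pos m ⟨hη.1.trans_lt hs.1, hs.2⟩) (fun s _ => by simp)
    (intervalIntegrable_eval_mul_weight hm ⟨hη.1, hη.2.le⟩ 1)

lemma integral_weight_eq_two_mul (hm : 2 ≤ m) :
    ∫ s in (-1 : ℝ)..1, weight m s = 2 * ∫ s in (0 : ℝ)..1, weight m s := by
  have hi := intervalIntegrable_weight hm
  have h₁ : IntervalIntegrable (weight m) volume (-1) 0 := hi.mono_set (by
    rw [Set.uIcc_of_le (by norm_num), Set.uIcc_of_le (by norm_num)]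
    exact Set.Icc_subset_Icc_right (by norm_num))
  have h₂ : IntervalIntegrable (weight m) volume 0 1 := hi.mono_set (by
    rw [Set.uIcc_of_le (by norm_num), Set.uIcc_of_le (by norm_num)]
    exact Set.Icc_subset_Icc_left (by norm_num))
  have h₃ : ∫ s in (-1 : ℝ)..0, weight m s = ∫ s in (0 : ℝ)..1, weight m s := by
    have := intervalIntegral.integral_comp_neg (a := 0) (b := 1) (weight m)
    simp only [weight, neg_sq, neg_zero] at this ⊢
    exact this.symm
  rw [← intervalIntegral.integral_add_adjacent_intervals h₁ h₂, h₃, two_mul]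

variable {σ : Measure (EuclideanSpace ℝ (Fin m))}

lemma integral_truncEval_inner (hm : 2 ≤ m) [IsProbabilityMeasure σ] (hσ : ∀ᵐ z ∂σ, ‖z‖ = 1)
    (hinv : ∀ g : EuclideanSpace ℝ (Fin m) ≃ₗᵢ[ℝ] EuclideanSpace ℝ (Fin m), σ.map g = σ)
    {x : EuclideanSpace ℝ (Fin m)} (hx : ‖x‖ = 1) {η : ℝ} (hη : η ∈ Set.Icc (-1 : ℝ) 1)
    (f : ℝ[X]) :
    ∫ z, truncEval η f (inner ℝ x z) ∂σ =
      (∫ s in η..1, f.eval s * weight m s) / ∫ s in (-1 : ℝ)..1, weight m s := by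
  obtain ⟨B, hB⟩ := exists_bound_truncEval η f
  rw [eq_div_iff (integral_weight_pos hm (by norm_num)).ne', mul_comm,
    integral_comp_inner hm hσ hinv hx (measurable_truncEval η f) hB, integral_truncEval_mul hη]

/-- The moments of a design against a harmonic of positive degree vanish. -/
lemma sum_integral_inner_pow_mul_eq_zero (hm : 2 ≤ m) [IsProbabilityMeasure σ]
    (hσ : ∀ᵐ z ∂σ, ‖z‖ = 1)
    (hinv : ∀ g : EuclideanSpace ℝ (Fin m) ≃ₗᵢ[ℝ] EuclideanSpace ℝ (Fin m), σ.map g = σ)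
    {X : Finset (EuclideanSpace ℝ (Fin m))} {N : ℕ} (hN : 0 < N) {t : ℕ}
    (hdesign : ∀ f : MvPolynomial (Fin m) ℝ, f.totalDegree ≤ t →
      (1 / (N : ℝ)) * ∑ x ∈ X, polyFun f x = ∫ z, polyFun f z ∂σ)
    {k : ℕ} (hk : k ≤ t) {Y : MvPolynomial (Fin m) ℝ} (hY : ∫ z, polyFun Y z ∂σ = 0) :
    ∑ x ∈ X, ∫ z, inner ℝ x z ^ k * polyFun Y z ∂σ = 0 := by
  have hpow (x z : EuclideanSpace ℝ (Fin m)) : polyFun (linearForm x ^ k) z = inner ℝ x z ^ k := by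
    rw [← polyFun_linearForm]
    simp [polyFun]
  have hintegrable (x : EuclideanSpace ℝ (Fin m)) :
      Integrable (fun z => inner ℝ x z ^ k * polyFun Y z) σ := by
    refine (integrable_polyFun hσ (linearForm x ^ k * Y)).congr (ae_of_all _ fun z => ?_)
    simp only [← hpow, polyFun, map_mul]
  obtain ⟨M, hM⟩ : ∃ M, ∀ z : EuclideanSpace ℝ (Fin m), ‖z‖ = 1 →
      ∑ x ∈ X, inner ℝ x z ^ k = M := by
    refine ⟨N * ((∫ s in (-1 : ℝ)..1, (Polynomial.X ^ k : ℝ[X]).eval s * weight m s) /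
        ∫ s in (-1 : ℝ)..1, weight m s), fun z hz => ?_⟩
    have hdeg : (linearForm z ^ k).totalDegree ≤ t := by
      refine (MvPolynomial.totalDegree_pow _ _).trans ?_
      have : (linearForm z).totalDegree ≤ 1 := by
        refine MvPolynomial.totalDegree_finsetSum_le fun i _ => ?_
        refine (MvPolynomial.totalDegree_mul _ _).trans ?_
        simp
      nlinarith
    have h := hdesign _ hdeg
    have hX : ∑ x ∈ X, inner ℝ x z ^ k = N * ∫ y, inner ℝ z y ^ k ∂σ := by
      simp only [hpow] at h
      rw [← h]
      simp only [real_inner_comm]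
      field_simp
    rw [hX, ← integral_truncEval_inner hm hσ hinv hz (η := -1) (by norm_num)]
    congr 1
    refine integral_congr_ae ?_
    filter_upwards [hσ] with y hy
    rw [truncEval, Set.indicator_of_mem (inner_mem_Icc_of_norm_eq_one hz hy)]
    simp
  rw [← integral_finsetSum _ fun x _ => hintegrable x]
  simp_rw [← Finset.sum_mul]
  rw [integral_congr_ae (g := fun z => M * polyFun Y z) (by
      filter_upwards [hσ] with z hz
      rw [hM z hz]), integral_const_mul, hY, mul_zero]

lemma exists_bound_sum_truncEval (X : Finset (EuclideanSpace ℝ (Fin m))) (η : ℝ) (f : ℝ[X]) :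
    ∃ B, ∀ z, ‖∑ x ∈ X, truncEval η f (inner ℝ x z)‖ ≤ B := by
  obtain ⟨B, hB⟩ := exists_bound_truncEval η f
  exact ⟨∑ _x ∈ X, B, fun z => norm_sum_le_of_le X fun x _ => hB _⟩

lemma measurable_sum_truncEval (X : Finset (EuclideanSpace ℝ (Fin m))) (η : ℝ) (f : ℝ[X]) :
    Measurable fun z => ∑ x ∈ X, truncEval η f (inner ℝ x z) :=
  Finset.measurable_fun_sum X fun x _ => (measurable_truncEval η f).comp (by fun_prop)

lemma memLp_sum_truncEval [IsFiniteMeasure σ] (X : Finset (EuclideanSpace ℝ (Fin m))) (η : ℝ)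
    (f : ℝ[X]) (q : ENNReal) : MemLp (fun z => ∑ x ∈ X, truncEval η f (inner ℝ x z)) q σ := by
  obtain ⟨B, hB⟩ := exists_bound_sum_truncEval X η f
  exact MemLp.of_bound (measurable_sum_truncEval X η f).aestronglyMeasurable B (ae_of_all _ hB)

lemma integral_sum_truncEval (hm : 2 ≤ m) [IsProbabilityMeasure σ] (hσ : ∀ᵐ z ∂σ, ‖z‖ = 1)
    (hinv : ∀ g : EuclideanSpace ℝ (Fin m) ≃ₗᵢ[ℝ] EuclideanSpace ℝ (Fin m), σ.map g = σ)
    {X : Finset (EuclideanSpace ℝ (Fin m))} (hX : ∀ x ∈ X, ‖x‖ = 1) {η : ℝ}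
    (hη : η ∈ Set.Icc (-1 : ℝ) 1) (f : ℝ[X]) :
    ∫ z, ∑ x ∈ X, truncEval η f (inner ℝ x z) ∂σ =
      X.card * ((∫ s in η..1, f.eval s * weight m s) / ∫ s in (-1 : ℝ)..1, weight m s) := by
  rw [integral_finsetSum]
  · rw [Finset.sum_congr rfl fun x hx => integral_truncEval_inner hm hσ hinv (hX x hx) hη f,
      Finset.sum_const, nsmul_eq_mul]
  · intro x _
    simpa using (memLp_sum_truncEval {x} η f 1).integrable le_rfl (μ := σ)

/-- The Funk–Hecke formula for sums of truncated zonal polynomials. -/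
lemma funkHecke_sum_truncEval (hm : 2 ≤ m) [IsFiniteMeasure σ] (hσ : ∀ᵐ z ∂σ, ‖z‖ = 1)
    (hinv : ∀ g : EuclideanSpace ℝ (Fin m) ≃ₗᵢ[ℝ] EuclideanSpace ℝ (Fin m), σ.map g = σ)
    {Y : MvPolynomial (Fin m) ℝ} {k : ℕ}
    (hY : ∀ᵐ z ∂σ, polyFun (rotLaplacian Y) z = -(2 * eigenvalue m k) * polyFun Y z)
    {X : Finset (EuclideanSpace ℝ (Fin m))} (hX : ∀ x ∈ X, ‖x‖ = 1) {η : ℝ}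
    (hη : η ∈ Set.Icc (-1 : ℝ) 1) (f : ℝ[X]) :
    gegenbauerMoment hm k k * ∫ z, (∑ x ∈ X, truncEval η f (inner ℝ x z)) * polyFun Y z ∂σ =
      (∑ x ∈ X, ∫ z, inner ℝ x z ^ k * polyFun Y z ∂σ) *
        ∫ s in η..1, (f * gegenbauer hm k).eval s * weight m s := by
  obtain ⟨B, hB⟩ := exists_bound_truncEval η f
  simp_rw [Finset.sum_mul]
  rw [integral_finsetSum _ fun x _ => integrable_comp_mul (by fun_prop) (integrable_polyFun hσ Y)
    (measurable_truncEval η f) (ae_of_all _ fun z => hB _), Finset.mul_sum]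
  refine Finset.sum_congr rfl fun x hx => ?_
  rw [funkHecke hm hσ hinv hY (hX x hx) (measurable_truncEval η f) hB, integral_truncEval_mul hη]
  simp only [eval_mul, mul_assoc]

end Design

end SphericalDesign

open SphericalDesign in
/-- **Yudin's lower bound for antipodal spherical designs.**
If `X ⊂ S^{m-1}` is a finite antipodal set of cardinality `N` which is a spherical
`(p+1)`-design with respect to the rotation-invariant probability measure `σ`, and `Q` is a
nonzero polynomial of degree `p+1` orthogonal to all powers `s^j`, `j ≤ p`, for the weight
`(1-s²)^{(m-1)/2}`, with largest real root `η`, then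
`N ≥ 2 · (∫_0^1 (1-s²)^{(m-3)/2} ds) / (∫_η^1 (1-s²)^{(m-3)/2} ds)`. -/
theorem yudin_bound_antipodal_spherical_design
    (m : ℕ) (hm : 2 ≤ m) (p : ℕ) (hp : 0 < p) (hpe : Even p)
    (σ : Measure (EuclideanSpace ℝ (Fin m))) [IsProbabilityMeasure σ]
    (hσsupp : ∀ᵐ z ∂σ, ‖z‖ = 1)
    (hσinv : ∀ g : EuclideanSpace ℝ (Fin m) ≃ₗᵢ[ℝ] EuclideanSpace ℝ (Fin m),
      Measure.map g σ = σ)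
    (X : Finset (EuclideanSpace ℝ (Fin m))) (hXsph : ∀ x ∈ X, ‖x‖ = 1)
    (hXanti : ∀ x ∈ X, -x ∈ X)
    (N : ℕ) (hN : X.card = N) (hN0 : 0 < N)
    (hdesign : ∀ ψ : MvPolynomial (Fin m) ℝ, ψ.totalDegree ≤ p + 1 →
      (1 / (N : ℝ)) * ∑ x ∈ X, MvPolynomial.eval (fun k => x k) ψ
        = ∫ z, MvPolynomial.eval (fun k => z k) ψ ∂σ)
    (Q : Polynomial ℝ) (hQ : Q ≠ 0) (hQdeg : Q.natDegree = p + 1)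
    (hQorth : ∀ j : ℕ, j ≤ p →
      ∫ s in (-1:ℝ)..1, Q.eval s * s ^ j * (1 - s ^ 2) ^ (((m:ℝ) - 1) / 2) = 0)
    (η : ℝ) (hη : Q.eval η = 0) (hηmax : ∀ s : ℝ, Q.eval s = 0 → s ≤ η) :
    2 * (∫ s in (0:ℝ)..1, (1 - s ^ 2) ^ (((m:ℝ) - 3) / 2)) /
      (∫ s in η..1, (1 - s ^ 2) ^ (((m:ℝ) - 3) / 2)) ≤ (N : ℝ) := by
  have hQorth' : ∀ j < p + 1, ∫ s in (-1 : ℝ)..1, s ^ j * (Q.eval s * upperWeight m s) = 0 := by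
    intro j hj
    rw [← hQorth j (by omega)]
    exact intervalIntegral.integral_congr fun s _ => by simp only [upperWeight]; ring
  have hηmem : η ∈ Set.Ioo (-1 : ℝ) 1 := root_mem_Ioo hm hQ hQdeg hQorth' hη
  have hηIcc := Set.Ioo_subset_Icc_self hηmem
  obtain ⟨a, rfl⟩ := eq_C_mul_derivative_gegenbauer hm hQdeg hQorth'
  set ψ := gegenbauer hm (p + 1 + 1) with hψ
  have ha : a ≠ 0 := by
    rintro rfl
    simp at hQ
  have hcrit : (derivative ψ).eval η = 0 := by simpa [ha] using hη
  have hψdeg : ψ.natDegree = p + 1 + 1 := natDegree_gegenbauer hm _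
  have hdpos : ∀ s, η < s → 0 < (derivative ψ).eval s := fun s hs => by
    refine eval_pos_of_forall_root_le ?_ ?_ (fun u hu => hηmax u (by simp [hu])) hs
    · rw [degree_derivative (by omega)]
      exact_mod_cast (by omega : 0 < ψ.natDegree - 1)
    · rw [leadingCoeff_derivative, (monic_gegenbauer hm _).leadingCoeff]
      simp
  set φ := ψ - C (ψ.eval η) with hφ
  have hφpos : ∀ s, η < s → 0 < φ.eval s := fun s hs => by
    simpa [hφ] using eval_lt_eval_of_derivative_pos hdpos hs
  have hφ0 : φ ≠ 0 := fun h => by simpa [h] using hφpos (η + 1) (by linarith)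
  have hφint : 0 < ∫ s in η..1, φ.eval s * weight m s :=
    integral_eval_mul_pos hηmem.2 hφ0 (fun s hs => weight_pos m ⟨hηmem.1.trans hs.1, hs.2⟩)
      (fun s hs => (hφpos s hs.1).le) (intervalIntegrable_eval_mul_weight hm hηIcc φ)
  have hW : 0 < ∫ s in (-1 : ℝ)..1, weight m s := integral_weight_pos hm (by norm_num)
  have hcap : 0 < ∫ s in η..1, weight m s := integral_weight_pos hm ⟨hηmem.1.le, hηmem.2⟩
  set c := -(eigenvalue m (p + 1 + 1) * ψ.eval η) with hc
  have hcpos : 0 < c := by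
    have h₁ := integral_cap_gegenbauer hm (p + 1 + 1) 0 hηmem hcrit
    have h₂ := eigenvalue_lt hm (Nat.succ_pos (p + 1))
    rw [gegenbauer_zero, mul_one] at h₁
    simp only [eval_one, one_mul] at h₁
    exact pos_of_mul_pos_left (h₁ ▸ mul_pos (sub_pos.mpr h₂) hφint) hcap.le
  have hTL := memLp_sum_truncEval (σ := σ) X η 1 2
  have hUL := memLp_sum_truncEval (σ := σ) X η φ 2
  have hupper := integral_mul_le_of_harmonics hσsupp hTL hUL fun n => by
    have hJ := gegenbauerMoment_self_ne_zero hm (n + 1)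
    rcases le_or_gt (n + 1) (p + 1) with hn | hn
    · refine ⟨0, le_rfl, fun Y hYdeg hYorth => ?_⟩
      have hY := ae_polyFun_rotLaplacian_eq hσsupp hσinv hYdeg hYorth
      have h₁ := funkHecke_sum_truncEval hm hσsupp hσinv hY hXsph hηIcc 1
      have hY0 : ∫ z, polyFun Y z ∂σ = 0 := by simpa using hYorth 1 (by simp)
      rw [sum_integral_inner_pow_mul_eq_zero hm hσsupp hσinv hN0 hdesign hn hY0, zero_mul] at h₁
      rw [zero_mul]
      exact (mul_eq_zero.mp h₁).resolve_left hJ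
    · refine ⟨(eigenvalue m (p + 1 + 1) - eigenvalue m (n + 1)) / c,
        div_nonpos_of_nonpos_of_nonneg ?_ hcpos.le, fun Y hYdeg hYorth => ?_⟩
      · rcases (show p + 1 + 1 ≤ n + 1 from hn).eq_or_lt with h | h
        · rw [h, sub_self]
        · exact (sub_neg.mpr (eigenvalue_lt hm h)).le
      · have hY := ae_polyFun_rotLaplacian_eq hσsupp hσinv hYdeg hYorth
        have h₁ := funkHecke_sum_truncEval hm hσsupp hσinv hY hXsph hηIcc 1
        have h₂ := funkHecke_sum_truncEval hm hσsupp hσinv hY hXsph hηIcc φ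
        have h₃ := integral_cap_gegenbauer hm (p + 1 + 1) (n + 1) hηmem hcrit
        rw [← hc] at h₃
        rw [one_mul] at h₁
        rw [div_mul_eq_mul_div, eq_div_iff hcpos.ne']
        refine mul_left_cancel₀ hJ ?_
        linear_combination c * h₁ - (eigenvalue m (p + 1 + 1) - eigenvalue m (n + 1)) * h₂ +
          (∑ x ∈ X, ∫ z, inner ℝ x z ^ (n + 1) * polyFun Y z ∂σ) * h₃
  have hφnonneg (s : ℝ) : 0 ≤ truncEval η φ s := by
    refine Set.indicator_nonneg (fun u hu => ?_) s
    rcases hu.1.eq_or_lt with rfl | h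
    · simp [hφ]
    · exact (hφpos u h).le
  have hχnonneg (s : ℝ) : 0 ≤ truncEval η 1 s := Set.indicator_nonneg (fun u _ => by simp) s
  have hχφ (s : ℝ) : truncEval η φ s = truncEval η 1 s * truncEval η φ s := by
    by_cases hs : s ∈ Set.Icc η 1 <;> simp [truncEval, hs]
  have hlower : ∫ z, ∑ x ∈ X, truncEval η φ (inner ℝ x z) ∂σ ≤
      ∫ z, (∑ x ∈ X, truncEval η 1 (inner ℝ x z)) * ∑ x ∈ X, truncEval η φ (inner ℝ x z) ∂σ := by
    refine integral_mono (hUL.integrable one_le_two) (hTL.integrable_mul hUL) fun z => ?_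
    simp only [Finset.mul_sum]
    refine Finset.sum_le_sum fun x hx => ?_
    refine (hχφ _).trans_le (mul_le_mul_of_nonneg_right
      (Finset.single_le_sum (f := fun x => truncEval η 1 (inner ℝ x z))
        (fun y _ => hχnonneg _) hx) (hφnonneg _))
  have hbound := hlower.trans hupper
  rw [integral_sum_truncEval hm hσsupp hσinv hXsph hηIcc,
    integral_sum_truncEval hm hσsupp hσinv hXsph hηIcc, hN] at hbound
  have hNpos : (0 : ℝ) < N := by exact_mod_cast hN0
  have hone := le_of_mul_le_mul_right ((one_mul _).trans_le hbound) (by positivity)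
  simp only [eval_one, one_mul] at hone
  rw [mul_div_assoc', le_div_iff₀ hW, one_mul, integral_weight_eq_two_mul hm] at hone
  exact (div_le_iff₀ hcap).mpr hone
end
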